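/- arXiv:2509.18857 — 10 statements merged into one kernel-verified Lean document; each statement's English description precedes it below -/
import Mathlib

section
/- Let w ∈ W and θ ∈ Θ with θ₀ ≤ 0. Then there exists θ̃ ∈ Θ such that MSE(w,θ) ≤ MSE(w,θ̃), θ̃₀ = θ₀, and θ̃ᵢ ≥ θ̃₀ for all i = 1,…,n; specifically, the vector θ̃ defined by θ̃₀ = θ₀ and θ̃ᵢ = θᵢ + 2·max{0, θ₀ − θᵢ} for i = 1,…,n has these properties. -/
/- STATEMENT 0: existence of the modified parameter vector θ̃ ∈ Θ with
   θ̃₀ = θ₀, θ̃ᵢ ≥ θ̃₀, and MSE(w,θ) ≤ MSE(w,θ̃), given explicitly by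
   θ̃ᵢ = θᵢ + 2·max{0, θ₀ − θᵢ}. -/

open Finset

/-- The weight set `W = {w ∈ ℝⁿ : ∑ wᵢ ≤ 1, wᵢ ≥ 0}`. -/
def Wset (n : ℕ) : Set (Fin n → ℝ) :=
  {w | (∑ i, w i) ≤ 1 ∧ ∀ i, 0 ≤ w i}

/-- The parameter set `Θ` (Lipschitz class with values in [-1/2,1/2]). -/
def ThetaSet {E : Type*} [NormedAddCommGroup E] (n : ℕ) (C : ℝ)
    (R : Fin (n + 1) → E) : Set (Fin (n + 1) → ℝ) :=
  {θ | (∀ i, θ i ∈ Set.Icc (-(1 / 2) : ℝ) (1 / 2)) ∧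
    ∀ i j, |θ i - θ j| ≤ C * ‖R i - R j‖}

/-- The mean squared error of the linear-shrinkage estimator with weights `w`. -/
noncomputable def MSE (n : ℕ) (w : Fin n → ℝ) (θ : Fin (n + 1) → ℝ) : ℝ :=
  (∑ i, w i * θ i.succ - θ 0) ^ 2 + ∑ i, (w i) ^ 2 * (1 / 4 - (θ i.succ) ^ 2)

/-- Adding `2 * max 0 (a - x)` to `x` reflects it into `[a, ∞)`. -/
theorem add_two_mul_max_eq (a x : ℝ) : x + 2 * max 0 (a - x) = a + |x - a| := by
  rcases le_total x a with h | h
  · rw [max_eq_right (by linarith), abs_of_nonpos (by linarith)]; ring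
  · rw [max_eq_left (by linarith), abs_of_nonneg (by linarith)]; ring

theorem reflect_mem_thetaSet {E : Type*} [NormedAddCommGroup E] {n : ℕ} {C : ℝ}
    {R : Fin (n + 1) → E} {θ : Fin (n + 1) → ℝ} (hθ : θ ∈ ThetaSet n C R) (hθ0 : θ 0 ≤ 0) :
    (fun i => θ 0 + |θ i - θ 0|) ∈ ThetaSet n C R := by
  refine ⟨fun i => ?_, fun i j => ?_⟩
  · have h0 := hθ.1 0
    have hi := hθ.1 i
    simp only [Set.mem_Icc] at h0 hi ⊢
    have habs : |θ i - θ 0| ≤ 1 / 2 - θ 0 := abs_le.2 ⟨by linarith, by linarith⟩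
    constructor <;> linarith [abs_nonneg (θ i - θ 0)]
  · calc |θ 0 + |θ i - θ 0| - (θ 0 + |θ j - θ 0|)|
        = |(|θ i - θ 0| - |θ j - θ 0|)| := by rw [add_sub_add_left_eq_sub]
      _ ≤ |θ i - θ 0 - (θ j - θ 0)| := abs_abs_sub_abs_le_abs_sub _ _
      _ = |θ i - θ j| := by rw [sub_sub_sub_cancel_right]
      _ ≤ C * ‖R i - R j‖ := hθ.2 i j

theorem MSE_le_MSE_reflect {n : ℕ} {w : Fin n → ℝ} (hw : w ∈ Wset n)
    {θ : Fin (n + 1) → ℝ} (hθ0 : θ 0 ≤ 0) :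
    MSE n w θ ≤ MSE n w (fun i => θ 0 + |θ i - θ 0|) := by
  have hbias : (∑ i, w i * θ i.succ - θ 0) ^ 2 ≤
      (∑ i, w i * (θ 0 + |θ i.succ - θ 0|) - θ 0) ^ 2 := by
    have hle : ∑ i, w i * θ i.succ ≤ ∑ i, w i * (θ 0 + |θ i.succ - θ 0|) :=
      sum_le_sum fun i _ => mul_le_mul_of_nonneg_left
        (by linarith [le_abs_self (θ i.succ - θ 0)]) (hw.2 i)
    have hsum : (∑ i, w i) * (2 * θ 0) ≤
        ∑ i, w i * θ i.succ + ∑ i, w i * (θ 0 + |θ i.succ - θ 0|) := by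
      rw [sum_mul, ← sum_add_distrib]
      refine sum_le_sum fun i _ => ?_
      rw [← mul_add]
      exact mul_le_mul_of_nonneg_left
        (by linarith [neg_abs_le (θ i.succ - θ 0)]) (hw.2 i)
    have hshrink : 2 * θ 0 ≤ (∑ i, w i) * (2 * θ 0) := by nlinarith [hw.1]
    exact sq_le_sq' (by linarith) (by linarith)
  have hvar : ∑ i, w i ^ 2 * (1 / 4 - θ i.succ ^ 2) ≤
      ∑ i, w i ^ 2 * (1 / 4 - (θ 0 + |θ i.succ - θ 0|) ^ 2) := by
    refine sum_le_sum fun i _ => mul_le_mul_of_nonneg_left ?_ (sq_nonneg _)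
    nlinarith [sq_abs (θ i.succ - θ 0), le_abs_self (θ i.succ - θ 0)]
  simpa [MSE] using add_le_add hbias hvar

theorem stmt0 {E : Type*} [NormedAddCommGroup E] (n : ℕ) (hn : 1 ≤ n)
    (C : ℝ) (hC : 0 < C) (R : Fin (n + 1) → E) (hR0 : R 0 = 0)
    (w : Fin n → ℝ) (hw : w ∈ Wset n)
    (θ : Fin (n + 1) → ℝ) (hθ : θ ∈ ThetaSet n C R) (hθ0 : θ 0 ≤ 0) :
    ∃ θt ∈ ThetaSet n C R,
      θt = (fun i => θ i + 2 * max 0 (θ 0 - θ i)) ∧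
      MSE n w θ ≤ MSE n w θt ∧ θt 0 = θ 0 ∧ ∀ i, θt 0 ≤ θt i := by
  have heq : (fun i => θ i + 2 * max 0 (θ 0 - θ i)) = fun i => θ 0 + |θ i - θ 0| :=
    funext fun i => add_two_mul_max_eq (θ 0) (θ i)
  refine ⟨_, reflect_mem_thetaSet hθ hθ0, heq.symm, MSE_le_MSE_reflect hw hθ0, ?_, fun i => ?_⟩
  · simp
  · simp
end

section
/- Let w ∈ W and let θ, θ' ∈ ℝ^{n+1} satisfy θ'₀ = θ₀ ≤ 0 and θ₀ ≤ θᵢ ≤ θ'ᵢ for all i = 1,…,n. Then MSE(w,θ) ≤ MSE(w,θ'). (Equivalently, on the set {θ : θ₀ ≤ 0 and θᵢ ≥ θ₀ for all i ≥ 1}, the function MSE(w,·) is coordinatewise nondecreasing in each θⱼ, j = 1,…,n, since ∂MSE/∂θⱼ = 2wⱼ(∑_{i≠j} wᵢθᵢ − θ₀) ≥ 0 there.) -/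
/- STATEMENT 1: coordinatewise monotonicity of the MSE on the set
   {θ : θ₀ ≤ 0 and θᵢ ≥ θ₀ for all i ≥ 1}. -/

open Finset

/-- A sub-convex combination of values bounded below by `t ≤ 0` stays above `t` after dropping
one of its terms. -/
theorem add_mul_le_sum_of_mem_Wset {n : ℕ} {w : Fin n → ℝ} (hw : w ∈ Wset n)
    {x : Fin n → ℝ} {t : ℝ} (ht : t ≤ 0) (hx : ∀ i, t ≤ x i) (i : Fin n) :
    t + w i * x i ≤ ∑ j, w j * x j := by
  have h : w i * (x i - t) ≤ ∑ j, w j * (x j - t) :=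
    single_le_sum (f := fun j => w j * (x j - t))
      (fun j _ => mul_nonneg (hw.2 j) (sub_nonneg.2 (hx j))) (mem_univ i)
  simp only [mul_sub, sum_sub_distrib, ← sum_mul] at h
  nlinarith [hw.1, hw.2 i]

theorem stmt1 (n : ℕ) (hn : 1 ≤ n) (w : Fin n → ℝ) (hw : w ∈ Wset n)
    (θ θ' : Fin (n + 1) → ℝ)
    (h00 : θ' 0 = θ 0) (h0neg : θ 0 ≤ 0)
    (hlow : ∀ i : Fin n, θ 0 ≤ θ i.succ)
    (hup : ∀ i : Fin n, θ i.succ ≤ θ' i.succ) :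
    MSE n w θ ≤ MSE n w θ' := by
  have hθ := add_mul_le_sum_of_mem_Wset hw h0neg hlow
  have hθ' := add_mul_le_sum_of_mem_Wset hw h0neg fun i => (hlow i).trans (hup i)
  unfold MSE
  rw [h00, ← sub_nonneg]
  set S := ∑ i, w i * θ i.succ
  set T := ∑ i, w i * θ' i.succ
  have key : (T - θ 0) ^ 2 + ∑ i, w i ^ 2 * (1 / 4 - θ' i.succ ^ 2)
      - ((S - θ 0) ^ 2 + ∑ i, w i ^ 2 * (1 / 4 - θ i.succ ^ 2))
      = ∑ i, w i * (θ' i.succ - θ i.succ)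
          * ((T - (θ 0 + w i * θ' i.succ)) + (S - (θ 0 + w i * θ i.succ))) := by
    have hsum : ∑ i, w i * (θ' i.succ - θ i.succ)
          * ((T - (θ 0 + w i * θ' i.succ)) + (S - (θ 0 + w i * θ i.succ)))
        = (T - S) * (T + S - 2 * θ 0) + (∑ i, w i ^ 2 * (1 / 4 - θ' i.succ ^ 2)
          - ∑ i, w i ^ 2 * (1 / 4 - θ i.succ ^ 2)) := by
      have hTS : T - S = ∑ i, (w i * θ' i.succ - w i * θ i.succ) := by
        rw [sum_sub_distrib]
      rw [hTS, sum_mul, ← sum_sub_distrib, ← sum_add_distrib]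
      exact sum_congr rfl fun i _ => by ring
    rw [hsum]
    ring
  rw [key]
  exact sum_nonneg fun i _ => mul_nonneg (mul_nonneg (hw.2 i) (sub_nonneg.2 (hup i)))
    (add_nonneg (sub_nonneg.2 (hθ' i)) (sub_nonneg.2 (hθ i)))
end

section
/- Let w ∈ ℝⁿ satisfy ∑_{i=1}^n wᵢ ≤ 1 and wᵢ ≥ 0 for all i. Then the maximum of MSE(w,θ) over θ ∈ Θ equals the maximum of MSE(w, θ̃(t)) over t ∈ [−1/2, 0]; both maxima exist since Θ and [−1/2,0] are compact and MSE(w,·) is continuous. -/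
/- STATEMENT 3 (Theorem thm:max_problem): for w with ∑wᵢ ≤ 1 and wᵢ ≥ 0,
   max_{θ ∈ Θ} MSE(w,θ) = max_{t ∈ [−1/2,0]} MSE(w, θ̃(t)); both maxima exist. -/

open Finset

/-- The vector θ̃(t) defined by θ̃ᵢ(t) = min{t + C‖Rᵢ‖, 1/2}. -/
noncomputable def thetaTilde {E : Type*} [NormedAddCommGroup E] (n : ℕ) (C : ℝ)
    (R : Fin (n + 1) → E) (t : ℝ) : Fin (n + 1) → ℝ :=
  fun i => min (t + C * ‖R i‖) (1 / 2)

/-- The off-diagonal part of `(∑ i, c i) ^ 2` is monotone under domination in absolute value. -/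
theorem sq_sum_sub_sum_sq_le {ι : Type*} [Fintype ι] {v c : ι → ℝ} (h : ∀ i, |v i| ≤ c i) :
    (∑ i, v i) ^ 2 - ∑ i, v i ^ 2 ≤ (∑ i, c i) ^ 2 - ∑ i, c i ^ 2 := by
  have key : ∀ i j, 0 ≤ c i * c j - v i * v j := fun i j => by
    have h1 : v i * v j ≤ |v i| * |v j| := by
      rw [← abs_mul]
      exact le_abs_self _
    have h2 : |v i| * |v j| ≤ c i * c j :=
      mul_le_mul (h i) (h j) (abs_nonneg _) ((abs_nonneg _).trans (h i))
    linarith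
  have hsum : ∑ i, (c i * c i - v i * v i) ≤ ∑ i, ∑ j, (c i * c j - v i * v j) :=
    Finset.sum_le_sum fun i _ =>
      Finset.single_le_sum (f := fun j => c i * c j - v i * v j) (fun j _ => key i j)
        (Finset.mem_univ i)
  simp only [Finset.sum_sub_distrib, ← Finset.sum_mul_sum, ← pow_two] at hsum
  linarith

/-- Expansion of the mean squared error around the value `θ 0`. -/
theorem MSE_eq_expansion (n : ℕ) (w : Fin n → ℝ) (θ : Fin (n + 1) → ℝ) :
    MSE n w θ =
      ((∑ i, w i * (θ i.succ - θ 0)) ^ 2 - ∑ i, (w i * (θ i.succ - θ 0)) ^ 2)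
      + 2 * (-θ 0) * ((1 - ∑ i, w i) * ∑ i, w i * (θ i.succ - θ 0)
        + ∑ i, w i * (w i * (θ i.succ - θ 0)))
      + (((∑ i, w i) - 1) ^ 2 * θ 0 ^ 2 + ∑ i, w i ^ 2 * (1 / 4 - θ 0 ^ 2)) := by
  have hsq : ∑ i, w i ^ 2 * (1 / 4 - θ i.succ ^ 2) =
      -∑ i, (w i * (θ i.succ - θ 0)) ^ 2
      + 2 * (-θ 0) * ∑ i, w i * (w i * (θ i.succ - θ 0))
      + ∑ i, w i ^ 2 * (1 / 4 - θ 0 ^ 2) := by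
    rw [Finset.mul_sum, ← Finset.sum_neg_distrib, ← Finset.sum_add_distrib,
      ← Finset.sum_add_distrib]
    exact Finset.sum_congr rfl fun i _ => by ring
  have hlin : ∑ i, w i * θ i.succ = ∑ i, w i * (θ i.succ - θ 0) + (∑ i, w i) * θ 0 := by
    rw [Finset.sum_mul, ← Finset.sum_add_distrib]
    exact Finset.sum_congr rfl fun i _ => by ring
  rw [MSE, hsq, hlin]
  ring

theorem MSE_neg (n : ℕ) (w : Fin n → ℝ) (θ : Fin (n + 1) → ℝ) :
    MSE n w (-θ) = MSE n w θ := by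
  simp only [MSE, Pi.neg_apply, mul_neg, Finset.sum_neg_distrib, neg_sq]
  ring

theorem MSE_le_of_abs_sub_le {n : ℕ} {w : Fin n → ℝ} (hw1 : ∑ i, w i ≤ 1)
    (hw2 : ∀ i, 0 ≤ w i) {θ η : Fin (n + 1) → ℝ} (h0 : η 0 = θ 0) (hθ : θ 0 ≤ 0)
    (h : ∀ i : Fin n, |θ i.succ - θ 0| ≤ η i.succ - η 0) :
    MSE n w θ ≤ MSE n w η := by
  have hle : ∀ i, w i * (θ i.succ - θ 0) ≤ w i * (η i.succ - η 0) := fun i =>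
    mul_le_mul_of_nonneg_left ((le_abs_self _).trans (h i)) (hw2 i)
  have hquad := sq_sum_sub_sum_sq_le (v := fun i => w i * (θ i.succ - θ 0))
    (c := fun i => w i * (η i.succ - η 0)) fun i => by
      rw [abs_mul, abs_of_nonneg (hw2 i)]
      exact mul_le_mul_of_nonneg_left (h i) (hw2 i)
  have hlin : (1 - ∑ i, w i) * ∑ i, w i * (θ i.succ - θ 0) ≤
      (1 - ∑ i, w i) * ∑ i, w i * (η i.succ - η 0) :=
    mul_le_mul_of_nonneg_left (Finset.sum_le_sum fun i _ => hle i) (sub_nonneg.2 hw1)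
  have hdiag : ∑ i, w i * (w i * (θ i.succ - θ 0)) ≤ ∑ i, w i * (w i * (η i.succ - η 0)) :=
    Finset.sum_le_sum fun i _ => mul_le_mul_of_nonneg_left (hle i) (hw2 i)
  have hcross := mul_le_mul_of_nonneg_left (add_le_add hlin hdiag)
    (show 0 ≤ 2 * (-θ 0) by linarith)
  rw [MSE_eq_expansion n w θ, MSE_eq_expansion n w η]
  rw [h0] at *
  linarith

theorem neg_mem_ThetaSet {E : Type*} [NormedAddCommGroup E] {n : ℕ} {C : ℝ}
    {R : Fin (n + 1) → E} {θ : Fin (n + 1) → ℝ} (h : θ ∈ ThetaSet n C R) :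
    -θ ∈ ThetaSet n C R := by
  refine ⟨fun i => ?_, fun i j => ?_⟩
  · obtain ⟨h1, h2⟩ := h.1 i
    exact ⟨by simpa using h2, by simpa using neg_le_neg h1⟩
  · rw [Pi.neg_apply, Pi.neg_apply, neg_sub_neg, abs_sub_comm]
    exact h.2 i j

theorem thetaTilde_mem_ThetaSet {E : Type*} [NormedAddCommGroup E] (n : ℕ) {C : ℝ}
    (hC : 0 ≤ C) (R : Fin (n + 1) → E) {t : ℝ} (ht : -(1 / 2) ≤ t) :
    thetaTilde n C R t ∈ ThetaSet n C R := by
  refine ⟨fun i => ⟨le_min ?_ (by norm_num), min_le_right _ _⟩, fun i j => ?_⟩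
  · have := mul_nonneg hC (norm_nonneg (R i))
    linarith
  · calc |thetaTilde n C R t i - thetaTilde n C R t j|
        ≤ |(t + C * ‖R i‖) - (t + C * ‖R j‖)| := by
          simpa [thetaTilde] using
            abs_min_sub_min_le_max (t + C * ‖R i‖) (1 / 2) (t + C * ‖R j‖) (1 / 2)
      _ = C * |‖R i‖ - ‖R j‖| := by
          rw [add_sub_add_left_eq_sub, ← mul_sub, abs_mul, abs_of_nonneg hC]
      _ ≤ C * ‖R i - R j‖ := mul_le_mul_of_nonneg_left (abs_norm_sub_norm_le _ _) hC

theorem MSE_le_MSE_thetaTilde {E : Type*} [NormedAddCommGroup E] {n : ℕ} {C : ℝ}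
    {R : Fin (n + 1) → E} (hR0 : R 0 = 0) {w : Fin n → ℝ} (hw1 : ∑ i, w i ≤ 1)
    (hw2 : ∀ i, 0 ≤ w i) {θ : Fin (n + 1) → ℝ} (hθ : θ ∈ ThetaSet n C R) (h0 : θ 0 ≤ 0) :
    MSE n w θ ≤ MSE n w (thetaTilde n C R (θ 0)) := by
  have heq : thetaTilde n C R (θ 0) 0 = θ 0 := by
    simp only [thetaTilde, hR0, norm_zero, mul_zero, add_zero]
    exact min_eq_left (by linarith)
  refine MSE_le_of_abs_sub_le hw1 hw2 heq h0 fun i => ?_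
  have hlip := hθ.2 i.succ 0
  rw [hR0, sub_zero] at hlip
  obtain ⟨h1, h2⟩ := hθ.1 i.succ
  obtain ⟨h3, -⟩ := hθ.1 0
  rw [heq, le_sub_iff_add_le]
  refine le_min (by linarith) ?_
  rw [← le_sub_iff_add_le]
  exact abs_le.2 ⟨by linarith, by linarith⟩

theorem stmt3 {E : Type*} [NormedAddCommGroup E] (n : ℕ) (hn : 1 ≤ n)
    (C : ℝ) (hC : 0 < C) (R : Fin (n + 1) → E) (hR0 : R 0 = 0)
    (w : Fin n → ℝ) (hw1 : (∑ i, w i) ≤ 1) (hw2 : ∀ i, 0 ≤ w i) :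
    ∃ m : ℝ,
      IsGreatest (MSE n w '' ThetaSet n C R) m ∧
      IsGreatest ((fun t => MSE n w (thetaTilde n C R t)) ''
        Set.Icc (-(1 / 2) : ℝ) 0) m := by
  have hcont : Continuous fun t => MSE n w (thetaTilde n C R t) := by
    unfold MSE thetaTilde
    fun_prop
  obtain ⟨m, hm⟩ := (isCompact_Icc.image hcont).exists_isGreatest
    ((Set.nonempty_Icc.2 (by norm_num : (-(1 / 2) : ℝ) ≤ 0)).image _)
  refine ⟨m, ⟨?_, ?_⟩, hm⟩
  · obtain ⟨t, ht, rfl⟩ := hm.1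
    exact ⟨_, thetaTilde_mem_ThetaSet n hC.le R ht.1, rfl⟩
  · have hnonpos : ∀ θ ∈ ThetaSet n C R, θ 0 ≤ 0 → MSE n w θ ≤ m := fun θ hθ h0 =>
      (MSE_le_MSE_thetaTilde hR0 hw1 hw2 hθ h0).trans (hm.2 ⟨θ 0, ⟨(hθ.1 0).1, h0⟩, rfl⟩)
    rintro _ ⟨θ, hθ, rfl⟩
    rcases le_total (θ 0) 0 with h0 | h0
    · exact hnonpos θ hθ h0
    · rw [← MSE_neg]
      exact hnonpos (-θ) (neg_mem_ThetaSet hθ) (by simpa using h0)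
end

section
/- Assume C‖Rᵢ‖ < 1/2 for all i = 1,…,n and let w ∈ W. Set u = ∑_{i=1}^n wᵢ, k = ∑_{i=1}^n wᵢ‖Rᵢ‖, and g(t) = MSE(w, θ̃(t)) for t ∈ [−1/2, 0]. If C·{k(1−u) + ∑_{i=1}^n wᵢ²‖Rᵢ‖} + (1/2)·{(1−u)² − ∑_{i=1}^n wᵢ²} ≥ 0, then max_{t ∈ [−1/2,0]} g(t) = g(−1/2). Otherwise, necessarily (1−u)² − ∑ wᵢ² < 0, the maximum is attained at t = β(w) := C·{k(1−u) + ∑ wᵢ²‖Rᵢ‖} / ((1−u)² − ∑ wᵢ²) ∈ (−1/2, 0], and max_{t ∈ [−1/2,0]} g(t) = C²k² + ∑_{i=1}^n wᵢ²(1/4 − C²‖Rᵢ‖²) − C²{k(1−u) + ∑_{i=1}^n wᵢ²‖Rᵢ‖}² / ((1−u)² − ∑_{i=1}^n wᵢ²). -/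
/- STATEMENT 7: closed form of the worst-case MSE, t ↦ MSE(w, θ̃(t)) on [−1/2,0].
   If C·{k(1−u) + ∑ wᵢ²‖Rᵢ‖} + (1/2)·{(1−u)² − ∑ wᵢ²} ≥ 0 the max is at t = −1/2;
   otherwise (1−u)² − ∑wᵢ² < 0, the max is at β(w) ∈ (−1/2,0] with an explicit value. -/

open Finset

/-- On `t ≤ 0` the truncation in `thetaTilde` is inactive, so the mean squared error is a quadratic
polynomial in `t`. -/
lemma MSE_thetaTilde_of_nonpos {E : Type*} [NormedAddCommGroup E] {n : ℕ} {C : ℝ}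
    {R : Fin (n + 1) → E} (hR0 : R 0 = 0) (hsmall : ∀ i : Fin n, C * ‖R i.succ‖ < 1 / 2)
    (w : Fin n → ℝ) {t : ℝ} (ht : t ≤ 0) :
    MSE n w (thetaTilde n C R t) =
      ((1 - ∑ i, w i) ^ 2 - ∑ i, (w i) ^ 2) * t ^ 2
        - 2 * C * ((∑ i, w i * ‖R i.succ‖) * (1 - ∑ i, w i)
          + ∑ i, (w i) ^ 2 * ‖R i.succ‖) * t
        + (C ^ 2 * (∑ i, w i * ‖R i.succ‖) ^ 2
          + ∑ i, (w i) ^ 2 * (1 / 4 - C ^ 2 * ‖R i.succ‖ ^ 2)) := by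
  have h_zero : thetaTilde n C R t 0 = t := by
    simp only [thetaTilde, hR0, norm_zero, mul_zero, add_zero]
    exact min_eq_left (by linarith)
  have h_succ (i : Fin n) : thetaTilde n C R t i.succ = t + C * ‖R i.succ‖ :=
    min_eq_left (by linarith [hsmall i])
  have h_linear : ∑ i, w i * (t + C * ‖R i.succ‖)
      = t * ∑ i, w i + C * ∑ i, w i * ‖R i.succ‖ := by
    simp only [mul_sum, ← sum_add_distrib]
    exact sum_congr rfl fun i _ => by ring
  have h_quadratic : ∑ i, (w i) ^ 2 * (1 / 4 - (t + C * ‖R i.succ‖) ^ 2)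
      = ∑ i, (w i) ^ 2 * (1 / 4 - C ^ 2 * ‖R i.succ‖ ^ 2) - t ^ 2 * ∑ i, (w i) ^ 2
        - 2 * C * t * ∑ i, (w i) ^ 2 * ‖R i.succ‖ := by
    simp only [mul_sum, ← sum_sub_distrib]
    exact sum_congr rfl fun i _ => by ring
  simp only [MSE, h_zero, h_succ, h_linear, h_quadratic]
  ring

theorem stmt7 {E : Type*} [NormedAddCommGroup E] (n : ℕ) (hn : 1 ≤ n)
    (C : ℝ) (hC : 0 < C) (R : Fin (n + 1) → E) (hR0 : R 0 = 0)
    (hsmall : ∀ i : Fin n, C * ‖R i.succ‖ < 1 / 2)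
    (w : Fin n → ℝ) (hw : w ∈ Wset n) :
    let u : ℝ := ∑ i, w i
    let k : ℝ := ∑ i, w i * ‖R i.succ‖
    let A : ℝ := k * (1 - u) + ∑ i, (w i) ^ 2 * ‖R i.succ‖
    let D : ℝ := (1 - u) ^ 2 - ∑ i, (w i) ^ 2
    let g : ℝ → ℝ := fun t => MSE n w (thetaTilde n C R t)
    (0 ≤ C * A + (1 / 2) * D →
      ∀ t ∈ Set.Icc (-(1 / 2) : ℝ) 0, g t ≤ g (-(1 / 2))) ∧
    (C * A + (1 / 2) * D < 0 →
      D < 0 ∧ C * A / D ∈ Set.Ioc (-(1 / 2) : ℝ) 0 ∧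
      (∀ t ∈ Set.Icc (-(1 / 2) : ℝ) 0, g t ≤ g (C * A / D)) ∧
      g (C * A / D) =
        C ^ 2 * k ^ 2 + (∑ i, (w i) ^ 2 * (1 / 4 - C ^ 2 * ‖R i.succ‖ ^ 2))
          - C ^ 2 * A ^ 2 / D) := by
  intro u k A D g
  have hk : 0 ≤ k := sum_nonneg fun i _ => mul_nonneg (hw.2 i) (norm_nonneg _)
  have hA : 0 ≤ A := add_nonneg (mul_nonneg hk (sub_nonneg.2 hw.1))
    (sum_nonneg fun i _ => mul_nonneg (sq_nonneg _) (norm_nonneg _))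
  have hCA : 0 ≤ C * A := mul_nonneg hC.le hA
  obtain ⟨c, hc⟩ : ∃ c, c = C ^ 2 * k ^ 2
      + ∑ i, (w i) ^ 2 * (1 / 4 - C ^ 2 * ‖R i.succ‖ ^ 2) := ⟨_, rfl⟩
  have hg (t : ℝ) (ht : t ≤ 0) : g t = D * t ^ 2 - 2 * C * A * t + c := by
    rw [hc]
    exact MSE_thetaTilde_of_nonpos hR0 hsmall w ht
  rw [← hc]
  clear_value g D A
  refine ⟨fun h t ⟨ht, ht'⟩ => ?_, fun h => ?_⟩
  · rw [hg t ht', hg _ (by norm_num)]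
    have h_factor : D * (t - 1 / 2) - 2 * (C * A) ≤ 0 := by
      nlinarith [mul_nonneg h (by linarith : (0 : ℝ) ≤ 1 / 2 - t),
        mul_nonneg hCA (by linarith : (0 : ℝ) ≤ 1 / 2 + t)]
    nlinarith [mul_nonneg (by linarith : (0 : ℝ) ≤ t + 1 / 2) (neg_nonneg.2 h_factor)]
  · have hD : D < 0 := by linarith
    have h_nonpos : C * A / D ≤ 0 := div_nonpos_of_nonneg_of_nonpos hCA hD.le
    have h_max : g (C * A / D) = c - C ^ 2 * A ^ 2 / D := by
      rw [hg _ h_nonpos]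
      field_simp [hD.ne]
      ring
    refine ⟨hD, ⟨?_, h_nonpos⟩, fun t ⟨_, ht'⟩ => ?_, h_max⟩
    · rw [lt_div_iff_of_neg hD]
      linarith
    · have h_square : D * t ^ 2 - 2 * C * A * t + c
          = c - C ^ 2 * A ^ 2 / D + D * (t - C * A / D) ^ 2 := by
        field_simp [hD.ne]
        ring
      rw [h_max, hg t ht', h_square]
      linarith [mul_nonpos_of_nonpos_of_nonneg hD.le (sq_nonneg (t - C * A / D))]
end

section
/- Let w ∈ ℝⁿ satisfy wᵢ ≥ 0 for all i and ∑_{i=1}^n wᵢ = 1. Then max_{θ ∈ Θ_g} (∑_{i=1}^n wᵢθᵢ − θ₀)² = C²(∑_{i=1}^n wᵢ‖Rᵢ‖)², and consequently max_{θ ∈ Θ_g} MSE_g(w,θ) = C²(∑_{i=1}^n wᵢ‖Rᵢ‖)² + (1/4)∑_{i=1}^n wᵢ²; the maximum is attained at θᵢ = C‖Rᵢ‖, i = 0,…,n. -/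
/- STATEMENT 9: for nonnegative weights summing to one,
   max_{θ ∈ Θ_g} (∑ wᵢθᵢ − θ₀)² = C²(∑ wᵢ‖Rᵢ‖)², hence
   max_{θ ∈ Θ_g} MSE_g(w,θ) = C²(∑ wᵢ‖Rᵢ‖)² + (1/4)∑ wᵢ²,
   attained at θᵢ = C‖Rᵢ‖. -/

open Finset

/-- The unbounded Lipschitz parameter set `Θ_g`. -/
def ThetaG {E : Type*} [NormedAddCommGroup E] (n : ℕ) (C : ℝ)
    (R : Fin (n + 1) → E) : Set (Fin (n + 1) → ℝ) :=
  {θ | ∀ i j, |θ i - θ j| ≤ C * ‖R i - R j‖}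

/-- The Gaussian mean squared error (known variance 1/4). -/
noncomputable def MSEg (n : ℕ) (w : Fin n → ℝ) (θ : Fin (n + 1) → ℝ) : ℝ :=
  (∑ i, w i * θ i.succ - θ 0) ^ 2 + (1 / 4) * ∑ i, (w i) ^ 2

theorem norm_mem_ThetaG {E : Type*} [NormedAddCommGroup E] {n : ℕ} {C : ℝ} (hC : 0 ≤ C)
    (R : Fin (n + 1) → E) : (fun i => C * ‖R i‖) ∈ ThetaG n C R := by
  intro i j
  rw [← mul_sub, abs_mul, abs_of_nonneg hC]
  exact mul_le_mul_of_nonneg_left (abs_norm_sub_norm_le _ _) hC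

theorem bias_norm_sq {E : Type*} [NormedAddCommGroup E] {n : ℕ} (C : ℝ)
    {R : Fin (n + 1) → E} (hR0 : R 0 = 0) (w : Fin n → ℝ) :
    (∑ i, w i * (C * ‖R i.succ‖) - C * ‖R 0‖) ^ 2 =
      C ^ 2 * (∑ i, w i * ‖R i.succ‖) ^ 2 := by
  simp only [hR0, norm_zero, mul_zero, sub_zero, mul_left_comm _ C, ← mul_sum, mul_pow]

theorem bias_sq_le {E : Type*} [NormedAddCommGroup E] {n : ℕ} {C : ℝ}
    {R : Fin (n + 1) → E} (hR0 : R 0 = 0) {w : Fin n → ℝ} (hw0 : ∀ i, 0 ≤ w i)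
    (hw1 : ∑ i, w i = 1) {θ : Fin (n + 1) → ℝ} (hθ : θ ∈ ThetaG n C R) :
    (∑ i, w i * θ i.succ - θ 0) ^ 2 ≤ C ^ 2 * (∑ i, w i * ‖R i.succ‖) ^ 2 := by
  have centered : ∑ i, w i * θ i.succ - θ 0 = ∑ i, w i * (θ i.succ - θ 0) := by
    simp only [mul_sub, sum_sub_distrib, ← sum_mul, hw1, one_mul]
  rw [centered, ← mul_pow, ← sq_abs]
  refine pow_le_pow_left₀ (abs_nonneg _) ((abs_sum_le_sum_abs _ _).trans ?_) 2
  rw [mul_sum]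
  refine sum_le_sum fun i _ => ?_
  have h := hθ i.succ 0
  rw [hR0, sub_zero] at h
  rw [abs_mul, abs_of_nonneg (hw0 i), mul_left_comm]
  exact mul_le_mul_of_nonneg_left h (hw0 i)

theorem stmt9 {E : Type*} [NormedAddCommGroup E] (n : ℕ) (hn : 1 ≤ n)
    (C : ℝ) (hC : 0 < C) (R : Fin (n + 1) → E) (hR0 : R 0 = 0)
    (w : Fin n → ℝ) (hw0 : ∀ i, 0 ≤ w i) (hw1 : (∑ i, w i) = 1) :
    IsGreatest ((fun θ : Fin (n + 1) → ℝ => (∑ i, w i * θ i.succ - θ 0) ^ 2) ''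
        ThetaG n C R)
      (C ^ 2 * (∑ i, w i * ‖R i.succ‖) ^ 2) ∧
    IsGreatest (MSEg n w '' ThetaG n C R)
      (C ^ 2 * (∑ i, w i * ‖R i.succ‖) ^ 2 + (1 / 4) * ∑ i, (w i) ^ 2) ∧
    (fun i : Fin (n + 1) => C * ‖R i‖) ∈ ThetaG n C R ∧
    MSEg n w (fun i => C * ‖R i‖) =
      C ^ 2 * (∑ i, w i * ‖R i.succ‖) ^ 2 + (1 / 4) * ∑ i, (w i) ^ 2 := by
  have mem := norm_mem_ThetaG hC.le R
  have value : MSEg n w (fun i => C * ‖R i‖) =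
      C ^ 2 * (∑ i, w i * ‖R i.succ‖) ^ 2 + (1 / 4) * ∑ i, (w i) ^ 2 :=
    congrArg (· + (1 / 4) * ∑ i, (w i) ^ 2) (bias_norm_sq C hR0 w)
  refine ⟨⟨⟨_, mem, bias_norm_sq C hR0 w⟩, ?_⟩, ⟨⟨_, mem, value⟩, ?_⟩, mem, value⟩
  · rintro _ ⟨θ, hθ, rfl⟩
    exact bias_sq_le hR0 hw0 hw1 hθ
  · rintro _ ⟨θ, hθ, rfl⟩
    exact add_le_add_left (bias_sq_le hR0 hw0 hw1 hθ) _
end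

section
/- Assume ‖R₁‖ ≤ … ≤ ‖Rₙ‖. Let ŵ be a minimizer over W of w ↦ max_{θ∈Θ} MSE(w,θ) that additionally satisfies w₁ ≥ … ≥ wₙ and ŵᵢ = 0 whenever C‖Rᵢ‖ ≥ 1/2 (such a minimizer exists), and let w̃ be a minimizer over W of w ↦ max_{θ∈Θ_g} MSE_g(w,θ). If û := ∑_{i=1}^n ŵᵢ > 0, then 1 ≤ [max_{θ∈Θ} MSE(w̃,θ)] / [max_{θ∈Θ} MSE(ŵ,θ)] ≤ û⁻² ( 1 + C² ∑_{i=1}^n ŵᵢ²‖Rᵢ‖² / ((1/4)∑_{i=1}^n ŵᵢ²) ) ≤ 2 û⁻². -/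
/- STATEMENT 11 (Lemma lem:compare_gauss): comparison of the worst-case MSEs of
   the binary-minimax weights ŵ and the Gaussian-minimax weights w̃. -/

open Finset

theorem MSE_le_MSEg (n : ℕ) (w : Fin n → ℝ) (θ : Fin (n + 1) → ℝ) :
    MSE n w θ ≤ MSEg n w θ := by
  unfold MSE MSEg
  rw [Finset.mul_sum]
  refine add_le_add_right (Finset.sum_le_sum fun i _ => ?_) _
  nlinarith [mul_nonneg (sq_nonneg (w i)) (sq_nonneg (θ i.succ))]

theorem ThetaSet_subset_ThetaG {E : Type*} [NormedAddCommGroup E] (n : ℕ) (C : ℝ)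
    (R : Fin (n + 1) → E) : ThetaSet n C R ⊆ ThetaG n C R :=
  fun _ hθ => hθ.2

theorem zero_mem_ThetaSet {E : Type*} [NormedAddCommGroup E] {n : ℕ} {C : ℝ} (hC : 0 ≤ C)
    (R : Fin (n + 1) → E) : (fun _ => 0) ∈ ThetaSet n C R := by
  refine ⟨fun i => by norm_num, fun i j => ?_⟩
  simp only [sub_zero, abs_zero]
  positivity

theorem truncated_norm_mem_ThetaSet {E : Type*} [NormedAddCommGroup E] {n : ℕ} {C : ℝ}
    (hC : 0 ≤ C) (R : Fin (n + 1) → E) :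
    (fun i => min (C * ‖R i‖) (1 / 2)) ∈ ThetaSet n C R := by
  refine ⟨fun i => ⟨?_, min_le_right _ _⟩, fun i j => ?_⟩
  · have h : (0 : ℝ) ≤ min (C * ‖R i‖) (1 / 2) := le_min (by positivity) (by norm_num)
    linarith
  · calc |min (C * ‖R i‖) (1 / 2) - min (C * ‖R j‖) (1 / 2)|
        ≤ max |C * ‖R i‖ - C * ‖R j‖| |(1 / 2 : ℝ) - 1 / 2| := abs_min_sub_min_le_max _ _ _ _
      _ = C * |‖R i‖ - ‖R j‖| := by
        rw [sub_self, abs_zero, max_eq_left (abs_nonneg _), ← mul_sub, abs_mul, abs_of_nonneg hC]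
      _ ≤ C * ‖R i - R j‖ := by
        gcongr
        exact abs_norm_sub_norm_le _ _

/-- The worst-case Gaussian error of weights proportional to `w` and summing to one. -/
theorem MSEg_normalized_le {E : Type*} [NormedAddCommGroup E] {n : ℕ} {C : ℝ}
    {R : Fin (n + 1) → E} (hR0 : R 0 = 0) {w : Fin n → ℝ} (hw : ∀ i, 0 ≤ w i)
    (hu : 0 < ∑ i, w i) {θ : Fin (n + 1) → ℝ} (hθ : θ ∈ ThetaG n C R) :
    MSEg n (fun i => (∑ j, w j)⁻¹ * w i) θ ≤
      ((∑ i, w i)⁻¹) ^ 2 *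
        ((C * ∑ i, w i * ‖R i.succ‖) ^ 2 + (1 / 4) * ∑ i, (w i) ^ 2) := by
  have hbias : ∑ i, (∑ j, w j)⁻¹ * w i * θ i.succ - θ 0 =
      (∑ j, w j)⁻¹ * ∑ i, w i * (θ i.succ - θ 0) := by
    simp only [mul_sub, Finset.sum_sub_distrib, ← Finset.sum_mul, mul_assoc, ← Finset.mul_sum]
    field_simp
  have habs : |∑ i, w i * (θ i.succ - θ 0)| ≤ C * ∑ i, w i * ‖R i.succ‖ := by
    rw [Finset.mul_sum]
    refine (Finset.abs_sum_le_sum_abs _ _).trans (Finset.sum_le_sum fun i _ => ?_)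
    have h := hθ i.succ 0
    rw [hR0, sub_zero] at h
    rw [abs_mul, abs_of_nonneg (hw i), mul_left_comm]
    exact mul_le_mul_of_nonneg_left h (hw i)
  have hsq : (∑ i, w i * (θ i.succ - θ 0)) ^ 2 ≤ (C * ∑ i, w i * ‖R i.succ‖) ^ 2 :=
    sq_le_sq.mpr (habs.trans (le_abs_self _))
  unfold MSEg
  rw [hbias]
  simp only [mul_pow _ _ 2, ← Finset.mul_sum] at hsq ⊢
  rw [mul_add, mul_left_comm (1 / 4 : ℝ)]
  gcongr

theorem stmt11 {E : Type*} [NormedAddCommGroup E] (n : ℕ) (hn : 1 ≤ n)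
    (C : ℝ) (hC : 0 < C) (R : Fin (n + 1) → E) (hR0 : R 0 = 0)
    (hord : ∀ i j : Fin n, i ≤ j → ‖R i.succ‖ ≤ ‖R j.succ‖)
    (wh wt : Fin n → ℝ) (Mhat Mtil : ℝ)
    -- ŵ = wh : a minimizer of w ↦ max_{θ∈Θ} MSE(w,θ) over W, nonincreasing,
    -- with wᵢ = 0 whenever C‖Rᵢ‖ ≥ 1/2
    (hwhW : wh ∈ Wset n)
    (hwhmono : ∀ i j : Fin n, i ≤ j → wh j ≤ wh i)
    (hwhzero : ∀ i : Fin n, 1 / 2 ≤ C * ‖R i.succ‖ → wh i = 0)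
    (hMhat : IsGreatest (MSE n wh '' ThetaSet n C R) Mhat)
    (hwhmin : ∀ w' ∈ Wset n, ∀ b : ℝ,
      (∀ θ ∈ ThetaSet n C R, MSE n w' θ ≤ b) → Mhat ≤ b)
    -- w̃ = wt : a minimizer of w ↦ max_{θ∈Θ_g} MSE_g(w,θ) over W
    (hwtW : wt ∈ Wset n)
    (hwtmin : ∃ Mg : ℝ, IsGreatest (MSEg n wt '' ThetaG n C R) Mg ∧
      ∀ w' ∈ Wset n, ∀ b : ℝ, (∀ θ ∈ ThetaG n C R, MSEg n w' θ ≤ b) → Mg ≤ b)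
    -- Mtil : the worst-case (binary) MSE of wt over Θ
    (hMtil : IsGreatest (MSE n wt '' ThetaSet n C R) Mtil)
    (hu : 0 < ∑ i, wh i) :
    1 ≤ Mtil / Mhat ∧
    Mtil / Mhat ≤ ((∑ i, wh i)⁻¹) ^ 2 *
      (1 + C ^ 2 * (∑ i, (wh i) ^ 2 * ‖R i.succ‖ ^ 2) /
        ((1 / 4) * ∑ i, (wh i) ^ 2)) ∧
    ((∑ i, wh i)⁻¹) ^ 2 *
      (1 + C ^ 2 * (∑ i, (wh i) ^ 2 * ‖R i.succ‖ ^ 2) /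
        ((1 / 4) * ∑ i, (wh i) ^ 2)) ≤ 2 * ((∑ i, wh i)⁻¹) ^ 2 := by
  have hwh := hwhW.2
  have hV : 0 < (1 / 4 : ℝ) * ∑ i, (wh i) ^ 2 := by
    obtain ⟨i, hi, hpos⟩ := Finset.exists_lt_of_sum_lt
      (show ∑ _i : Fin n, (0 : ℝ) < ∑ i, wh i by simpa using hu)
    have : 0 < ∑ i, (wh i) ^ 2 :=
      Finset.sum_pos' (fun j _ => sq_nonneg _) ⟨i, hi, by positivity⟩
    positivity
  have hVM : (1 / 4 : ℝ) * ∑ i, (wh i) ^ 2 ≤ Mhat := by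
    have h := hMhat.2 ⟨_, zero_mem_ThetaSet hC.le R, rfl⟩
    simpa [MSE, ← Finset.sum_mul, mul_comm] using h
  have hM : 0 < Mhat := hV.trans_le hVM
  have hAM : (C * ∑ i, wh i * ‖R i.succ‖) ^ 2 + (1 / 4) * ∑ i, (wh i) ^ 2 -
      C ^ 2 * ∑ i, (wh i) ^ 2 * ‖R i.succ‖ ^ 2 ≤ Mhat := by
    have h := hMhat.2 ⟨_, truncated_norm_mem_ThetaSet hC.le R, rfl⟩
    refine le_of_eq_of_le ?_ h
    have htrunc : ∀ i : Fin n, wh i * min (C * ‖R i.succ‖) (1 / 2) = wh i * (C * ‖R i.succ‖) := by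
      intro i
      rcases le_total (1 / 2) (C * ‖R i.succ‖) with hi | hi
      · simp [hwhzero i hi]
      · rw [min_eq_left hi]
    have hbias : ∑ i, wh i * min (C * ‖R i.succ‖) (1 / 2) - min (C * ‖R 0‖) (1 / 2) =
        C * ∑ i, wh i * ‖R i.succ‖ := by
      rw [Finset.mul_sum, hR0, norm_zero, mul_zero, min_eq_left (by norm_num), sub_zero]
      exact Finset.sum_congr rfl fun i _ => by rw [htrunc, mul_left_comm]
    have hvar : ∑ i, (wh i) ^ 2 * (1 / 4 - (min (C * ‖R i.succ‖) (1 / 2)) ^ 2) =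
        (1 / 4) * ∑ i, (wh i) ^ 2 - C ^ 2 * ∑ i, (wh i) ^ 2 * ‖R i.succ‖ ^ 2 := by
      rw [Finset.mul_sum, Finset.mul_sum, ← Finset.sum_sub_distrib]
      refine Finset.sum_congr rfl fun i _ => ?_
      rw [mul_sub, ← mul_pow, htrunc]
      ring
    unfold MSE
    rw [hbias, hvar]
    ring
  have hBV : C ^ 2 * ∑ i, (wh i) ^ 2 * ‖R i.succ‖ ^ 2 ≤ (1 / 4) * ∑ i, (wh i) ^ 2 := by
    rw [Finset.mul_sum, Finset.mul_sum]
    refine Finset.sum_le_sum fun i _ => ?_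
    rcases le_total (1 / 2) (C * ‖R i.succ‖) with hi | hi
    · simp [hwhzero i hi]
    · have h : (C * ‖R i.succ‖) ^ 2 ≤ (1 / 2) ^ 2 := pow_le_pow_left₀ (by positivity) hi 2
      nlinarith [mul_le_mul_of_nonneg_left h (sq_nonneg (wh i))]
  have hB : 0 ≤ C ^ 2 * ∑ i, (wh i) ^ 2 * ‖R i.succ‖ ^ 2 := by positivity
  have hMtil_le : Mtil ≤ ((∑ i, wh i)⁻¹) ^ 2 *
      ((C * ∑ i, wh i * ‖R i.succ‖) ^ 2 + (1 / 4) * ∑ i, (wh i) ^ 2) := by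
    obtain ⟨Mg, hMg, hMgmin⟩ := hwtmin
    obtain ⟨θ, hθ, rfl⟩ := hMtil.1
    refine (MSE_le_MSEg n wt θ).trans
      ((hMg.2 ⟨θ, ThetaSet_subset_ThetaG n C R hθ, rfl⟩).trans (hMgmin _ ⟨?_, fun i => ?_⟩ _
        fun θ' hθ' => MSEg_normalized_le hR0 hwh hu hθ'))
    · rw [← Finset.mul_sum, inv_mul_cancel₀ hu.ne']
    · exact mul_nonneg (inv_nonneg.mpr hu.le) (hwh i)
  refine ⟨?_, ?_, ?_⟩
  · rw [one_le_div hM]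
    exact hwhmin wt hwtW Mtil fun θ hθ => hMtil.2 ⟨θ, hθ, rfl⟩
  · rw [div_le_iff₀ hM, mul_assoc]
    refine hMtil_le.trans (mul_le_mul_of_nonneg_left ?_ (sq_nonneg _))
    have h : C ^ 2 * (∑ i, (wh i) ^ 2 * ‖R i.succ‖ ^ 2) ≤
        C ^ 2 * (∑ i, (wh i) ^ 2 * ‖R i.succ‖ ^ 2) / ((1 / 4) * ∑ i, (wh i) ^ 2) * Mhat := by
      rw [div_mul_eq_mul_div, le_div_iff₀ hV]
      exact mul_le_mul_of_nonneg_left hVM hB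
    linarith
  · rw [mul_comm 2]
    refine mul_le_mul_of_nonneg_left ?_ (sq_nonneg _)
    linarith [(div_le_one hV).mpr hBV]
end

section
/- Let n be large enough that c₀x − n^{−1/3} ≤ Fₙ(x) ≤ c₁x + n^{−1/3} for all x ∈ [0,1], where Fₙ(x) = (1/n)·#{i : |Rᵢ| ≤ x}, 0 ≤ |R₁| ≤ … ≤ |Rₙ| ≤ 1, and c₁ > c₀ > 0 are constants. Set α = 1/3 and, for ε ∈ (0,1], N(ε) = max{i ∈ {1,…,n} : |Rᵢ| ≤ ε}. If ε > 2c₀⁻¹ n^{−α}, then ∑_{i=1}^{N(ε)} |Rᵢ| ≥ (N(ε) − n^{1−α})² / (2c₁ n). -/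
/- STATEMENT 13: if ε > 2c₀⁻¹ n^{−1/3} (and ε ≤ 1), then
   ∑_{i=1}^{N(ε)} |Rᵢ| ≥ (N(ε) − n^{2/3})² / (2c₁ n),
   where N(ε) is the number of observations with |Rᵢ| ≤ ε. -/

open Finset

/-- The empirical distribution function of |R₁|, …, |Rₙ|. -/
noncomputable def empDist (n : ℕ) (R : Fin n → ℝ) (x : ℝ) : ℝ :=
  (({i : Fin n | |R i| ≤ x} : Finset (Fin n)).card : ℝ) / n

/-- If each `a i` is nonnegative and at least the rank of `i` in `s` minus `m`, then the sum of `a`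
over `s` is at least half the square of the positive part of `#s - m`. -/
theorem sq_posPart_card_sub_le_two_mul_sum {ι : Type*} [LinearOrder ι] (a : ι → ℝ)
    (ha : ∀ i, 0 ≤ a i) (m : ℝ) (hm : 0 ≤ m) (s : Finset ι)
    (h : ∀ i ∈ s, ((s.filter (fun j => j ≤ i)).card : ℝ) - m ≤ a i) :
    (max 0 ((s.card : ℝ) - m)) ^ 2 ≤ 2 * ∑ i ∈ s, a i := by
  induction s using Finset.induction_on_max with
  | empty => simp [hm]
  | insert x s hx ih =>
    have hxs : x ∉ s := fun hmem => lt_irrefl x (hx x hmem)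
    have ih' := ih fun i hi => by
      refine le_trans ?_ (h i (mem_insert_of_mem hi))
      gcongr
      exact subset_insert x s
    have htop : ((s.card : ℝ) + 1) - m ≤ a x := by
      have hx' := h x (mem_insert_self x s)
      rw [filter_true_of_mem, card_insert_of_notMem hxs] at hx'
      · exact_mod_cast hx'
      · intro j hj
        rcases mem_insert.1 hj with rfl | hj
        · exact le_rfl
        · exact (hx j hj).le
    rw [sum_insert hxs, card_insert_of_notMem hxs]
    push_cast
    have hax := ha x
    rcases max_cases 0 ((s.card : ℝ) - m) with ⟨h1, h2⟩ | ⟨h1, h2⟩ <;>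
    rcases max_cases 0 ((s.card : ℝ) + 1 - m) with ⟨h3, h4⟩ | ⟨h3, h4⟩ <;>
    rw [h1] at ih' <;> rw [h3] <;> nlinarith

theorem stmt13 (n : ℕ) (hn : 1 ≤ n) (R : Fin n → ℝ)
    (hord : ∀ i j : Fin n, i ≤ j → |R i| ≤ |R j|)
    (hbd : ∀ i : Fin n, |R i| ≤ 1)
    (c₀ c₁ : ℝ) (hc₀ : 0 < c₀) (hc₀₁ : c₀ < c₁)
    (hF : ∀ x ∈ Set.Icc (0 : ℝ) 1,
      c₀ * x - (n : ℝ) ^ (-(1 / 3 : ℝ)) ≤ empDist n R x ∧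
      empDist n R x ≤ c₁ * x + (n : ℝ) ^ (-(1 / 3 : ℝ)))
    (ε : ℝ) (hε1 : ε ≤ 1)
    (hεlow : 2 * c₀⁻¹ * (n : ℝ) ^ (-(1 / 3 : ℝ)) < ε) :
    ((({i : Fin n | |R i| ≤ ε} : Finset (Fin n)).card : ℝ) -
        (n : ℝ) ^ ((2 : ℝ) / 3)) ^ 2 / (2 * c₁ * n) ≤
      ∑ i ∈ ({i : Fin n | |R i| ≤ ε} : Finset (Fin n)), |R i| := by
  have hn0 : (0 : ℝ) < n := by exact_mod_cast hn
  have hc₁ : 0 < c₁ := hc₀.trans hc₀₁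
  set r : ℝ := (n : ℝ) ^ (-(1 / 3 : ℝ)) with hr
  set m : ℝ := (n : ℝ) ^ ((2 : ℝ) / 3) with hm
  have hr0 : 0 < r := Real.rpow_pos_of_pos hn0 _
  have hm0 : 0 < m := Real.rpow_pos_of_pos hn0 _
  have hrm : r * n = m := by
    rw [hr, hm, ← Real.rpow_add_one hn0.ne']
    norm_num
  have hε0 : 0 < ε := lt_trans (by positivity) hεlow
  set s : Finset (Fin n) := {i : Fin n | |R i| ≤ ε} with hs
  have hms : m ≤ s.card := by
    have hlow : c₀ * ε - r ≤ (s.card : ℝ) / n := (hF ε ⟨hε0.le, hε1⟩).1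
    have hεr : 2 * r ≤ c₀ * ε := by
      calc 2 * r = c₀ * (2 * c₀⁻¹ * r) := by field_simp
        _ ≤ c₀ * ε := by gcongr
    rw [← hrm, ← le_div_iff₀ hn0]
    linarith
  have hrank : ∀ i ∈ s, ((s.filter (fun j => j ≤ i)).card : ℝ) - m ≤ c₁ * n * |R i| := by
    intro i _
    have hup := (hF |R i| ⟨abs_nonneg _, hbd i⟩).2
    rw [empDist, div_le_iff₀ hn0, add_mul, hrm] at hup
    have hcard : ((s.filter (fun j => j ≤ i)).card : ℝ) ≤
        (({j : Fin n | |R j| ≤ |R i|} : Finset (Fin n)).card : ℝ) := by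
      refine Nat.cast_le.2 (card_le_card fun j hj => ?_)
      exact mem_filter.2 ⟨mem_univ j, hord j i (mem_filter.1 hj).2⟩
    linarith
  have hsum := sq_posPart_card_sub_le_two_mul_sum (fun i => c₁ * n * |R i|)
    (fun i => by positivity) m hm0.le s hrank
  rw [max_eq_right (sub_nonneg.2 hms), ← mul_sum] at hsum
  rw [div_le_iff₀ (by positivity)]
  linarith
end

section
/- For any γ ∈ ℝ and any τ₀ ∈ [−1, 1], the supremum over (p₊,p₋) ∈ P(τ₀) of P_{(p₊,p₋)}(τ̂ > γ) equals the maximum over p ∈ [max{0,τ₀}, min{1, 1+τ₀}] of P_{p̃(p,τ₀)}(τ̂ > γ), where p̃₊(p) = (p, min{p + C‖R_{1,+}‖, 1}, …, min{p + C‖R_{n₊,+}‖, 1}), p̃₋(p) = (p, max{p − C‖R_{1,−}‖, 0}, …, max{p − C‖R_{n₋,−}‖, 0}), and p̃(p,τ₀) = (p̃₊(p), p̃₋(p − τ₀)); the maximum on the right-hand side is attained. -/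
/- STATEMENT 14 (Theorem thm:inference): for nonnegative weights and binary
   outcomes, the supremum over P(τ₀) of P_{(p₊,p₋)}(τ̂ > γ) is attained and
   equals the maximum over p ∈ [max{0,τ₀}, min{1,1+τ₀}] of the rejection
   probability at the extremal parameter p̃(p,τ₀). -/

open Finset

/-- The probability of a configuration `y` of independent Bernoulli variables
with success probabilities `p₁, …, p_k` (coordinates `1,…,k` of `p`). -/
noncomputable def bernProb {k : ℕ} (p : Fin (k + 1) → ℝ) (y : Fin k → Bool) : ℝ :=
  ∏ i, if y i then p i.succ else 1 - p i.succ

/-- The estimator τ̂ evaluated at a configuration of binary outcomes. -/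
noncomputable def tauHat {k m : ℕ} (wp : Fin k → ℝ) (wm : Fin m → ℝ)
    (yp : Fin k → Bool) (ym : Fin m → Bool) : ℝ :=
  ∑ i, wp i * ((if yp i then (1 : ℝ) else 0) - 1 / 2) -
    ∑ i, wm i * ((if ym i then (1 : ℝ) else 0) - 1 / 2)

/-- The rejection probability P_{(p₊,p₋)}(τ̂ > γ) for independent Bernoulli
outcomes. -/
noncomputable def rejProb {k m : ℕ} (wp : Fin k → ℝ) (wm : Fin m → ℝ)
    (pp : Fin (k + 1) → ℝ) (pm : Fin (m + 1) → ℝ) (γ : ℝ) : ℝ :=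
  ∑ yp : Fin k → Bool, ∑ ym : Fin m → Bool,
    bernProb pp yp * bernProb pm ym *
      (if γ < tauHat wp wm yp ym then 1 else 0)

/-- The Lipschitz parameter set `P` of success-probability vectors. -/
def Pset {E : Type*} [NormedAddCommGroup E] (k : ℕ) (C : ℝ)
    (R : Fin (k + 1) → E) : Set (Fin (k + 1) → ℝ) :=
  {p | (∀ i, p i ∈ Set.Icc (0 : ℝ) 1) ∧ ∀ i j, |p i - p j| ≤ C * ‖R i - R j‖}

/-- The expectation of a monotone function of independent Bernoulli variables is monotone in the
success probabilities. -/
theorem sum_bernoulli_mul_mono {n : ℕ} {p q : Fin n → ℝ} {f : (Fin n → Bool) → ℝ}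
    (hp : ∀ i, 0 ≤ p i) (hpq : ∀ i, p i ≤ q i) (hq : ∀ i, q i ≤ 1) (hf : Monotone f) :
    ∑ y : Fin n → Bool, (∏ i, if y i then p i else 1 - p i) * f y ≤
      ∑ y : Fin n → Bool, (∏ i, if y i then q i else 1 - q i) * f y := by
  induction n with
  | zero => simp
  | succ n ih =>
    have cons_sum (r : Fin (n + 1) → ℝ) :
        ∑ y : Fin (n + 1) → Bool, (∏ i, if y i then r i else 1 - r i) * f y =
          r 0 * ∑ y : Fin n → Bool,
              (∏ i, if y i then r i.succ else 1 - r i.succ) * f (Fin.cons true y) +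
            (1 - r 0) * ∑ y : Fin n → Bool,
              (∏ i, if y i then r i.succ else 1 - r i.succ) * f (Fin.cons false y) := by
      rw [← (Fin.consEquiv fun _ : Fin (n + 1) => Bool).sum_comp, Fintype.sum_prod_type]
      simp [Fin.consEquiv, Fin.prod_univ_succ, Finset.mul_sum, mul_assoc]
    have cons_mono (b : Bool) :
        Monotone fun y : Fin n → Bool => f (Fin.cons b y : Fin (n + 1) → Bool) :=
      fun y z hyz => hf (Fin.cons_le_cons.2 ⟨le_rfl, hyz⟩)
    have htrue := ih (fun i => hp i.succ) (fun i => hpq i.succ) (fun i => hq i.succ)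
      (cons_mono true)
    have hfalse := ih (fun i => hp i.succ) (fun i => hpq i.succ) (fun i => hq i.succ)
      (cons_mono false)
    have hle : ∑ y : Fin n → Bool,
          (∏ i, if y i then q i.succ else 1 - q i.succ) * f (Fin.cons false y) ≤
        ∑ y : Fin n → Bool,
          (∏ i, if y i then q i.succ else 1 - q i.succ) * f (Fin.cons true y) := by
      refine Finset.sum_le_sum fun y _ => mul_le_mul_of_nonneg_left
        (hf (Fin.cons_le_cons.2 ⟨Bool.false_le true, le_rfl⟩))
        (Finset.prod_nonneg fun i _ => ?_)
      split_ifs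
      · exact (hp _).trans (hpq _)
      · exact sub_nonneg.2 (hq _)
    rw [cons_sum p, cons_sum q]
    have h0 := hp 0
    have h1 := (hpq 0).trans (hq 0)
    nlinarith [mul_le_mul_of_nonneg_left htrue h0,
      mul_le_mul_of_nonneg_left hfalse (sub_nonneg.2 h1),
      mul_le_mul_of_nonneg_left hle (sub_nonneg.2 (hpq 0))]

theorem bernProb_nonneg {k : ℕ} {p : Fin (k + 1) → ℝ} (hp : ∀ i, p i ∈ Set.Icc (0 : ℝ) 1)
    (y : Fin k → Bool) : 0 ≤ bernProb p y := by
  refine Finset.prod_nonneg fun i _ => ?_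
  split_ifs
  · exact (hp _).1
  · exact sub_nonneg.2 (hp _).2

theorem sum_bernProb_mul_mono {k : ℕ} {p q : Fin (k + 1) → ℝ} {f : (Fin k → Bool) → ℝ}
    (hp : ∀ i, p i ∈ Set.Icc (0 : ℝ) 1) (hq : ∀ i, q i ∈ Set.Icc (0 : ℝ) 1)
    (hpq : ∀ i, p i ≤ q i) (hf : Monotone f) :
    ∑ y, bernProb p y * f y ≤ ∑ y, bernProb q y * f y :=
  sum_bernoulli_mul_mono (fun i => (hp i.succ).1) (fun i => hpq i.succ)
    (fun i => (hq i.succ).2) hf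

theorem sum_weight_mul_mono {k : ℕ} {w : Fin k → ℝ} (hw : ∀ i, 0 ≤ w i) :
    Monotone fun y : Fin k → Bool => ∑ i, w i * ((if y i then (1 : ℝ) else 0) - 1 / 2) := by
  intro y z hyz
  refine Finset.sum_le_sum fun i _ => mul_le_mul_of_nonneg_left ?_ (hw i)
  have h : y i = true → z i = true := hyz i
  cases hy : y i <;> cases hz : z i <;> simp_all

theorem rejProb_mono_left {k m : ℕ} {wp : Fin k → ℝ} (wm : Fin m → ℝ)
    {p q : Fin (k + 1) → ℝ} {r : Fin (m + 1) → ℝ} (γ : ℝ) (hwp : ∀ i, 0 ≤ wp i)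
    (hp : ∀ i, p i ∈ Set.Icc (0 : ℝ) 1) (hq : ∀ i, q i ∈ Set.Icc (0 : ℝ) 1)
    (hr : ∀ i, r i ∈ Set.Icc (0 : ℝ) 1) (hpq : ∀ i, p i ≤ q i) :
    rejProb wp wm p r γ ≤ rejProb wp wm q r γ := by
  simp only [rejProb, mul_assoc, ← Finset.mul_sum]
  refine sum_bernProb_mul_mono hp hq hpq fun y z hyz => Finset.sum_le_sum fun x _ =>
    mul_le_mul_of_nonneg_left ?_ (bernProb_nonneg hr x)
  have h : tauHat wp wm y x ≤ tauHat wp wm z x :=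
    sub_le_sub_right (sum_weight_mul_mono hwp hyz) _
  split_ifs <;> linarith

theorem rejProb_anti_right {k m : ℕ} (wp : Fin k → ℝ) {wm : Fin m → ℝ}
    {p : Fin (k + 1) → ℝ} {q r : Fin (m + 1) → ℝ} (γ : ℝ) (hwm : ∀ i, 0 ≤ wm i)
    (hp : ∀ i, p i ∈ Set.Icc (0 : ℝ) 1) (hq : ∀ i, q i ∈ Set.Icc (0 : ℝ) 1)
    (hr : ∀ i, r i ∈ Set.Icc (0 : ℝ) 1) (hqr : ∀ i, q i ≤ r i) :
    rejProb wp wm p r γ ≤ rejProb wp wm p q γ := by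
  simp only [rejProb, mul_assoc, ← Finset.mul_sum]
  refine Finset.sum_le_sum fun x _ => mul_le_mul_of_nonneg_left ?_ (bernProb_nonneg hp x)
  have key := sum_bernProb_mul_mono hq hr hqr
    (f := fun y => -(if γ < tauHat wp wm x y then (1 : ℝ) else 0)) fun y z hyz => by
      have h : tauHat wp wm x z ≤ tauHat wp wm x y :=
        sub_le_sub_left (sum_weight_mul_mono hwm hyz) _
      dsimp only
      split_ifs <;> linarith
  simpa only [mul_neg, Finset.sum_neg_distrib, neg_le_neg_iff] using key

theorem continuous_bernProb {k : ℕ} (y : Fin k → Bool) :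
    Continuous fun p : Fin (k + 1) → ℝ => bernProb p y := by
  refine continuous_finsetProd _ fun i _ => ?_
  split_ifs <;> fun_prop

theorem continuous_rejProb {k m : ℕ} (wp : Fin k → ℝ) (wm : Fin m → ℝ) (γ : ℝ) :
    Continuous fun pq : (Fin (k + 1) → ℝ) × (Fin (m + 1) → ℝ) =>
      rejProb wp wm pq.1 pq.2 γ :=
  continuous_finsetSum _ fun yp _ => continuous_finsetSum _ fun ym _ =>
    (((continuous_bernProb yp).comp continuous_fst).mul
      ((continuous_bernProb ym).comp continuous_snd)).mul continuous_const

theorem min_add_mul_norm_mem_Pset {E : Type*} [NormedAddCommGroup E] {k : ℕ} {C a : ℝ}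
    (hC : 0 ≤ C) (ha : 0 ≤ a) (R : Fin (k + 1) → E) :
    (fun i => min (a + C * ‖R i‖) 1) ∈ Pset k C R := by
  refine ⟨fun i => ⟨by positivity, min_le_right _ _⟩, fun i j => ?_⟩
  refine (abs_min_sub_min_le_max _ _ _ _).trans ?_
  rw [sub_self, abs_zero, max_eq_left (abs_nonneg _), add_sub_add_left_eq_sub, ← mul_sub,
    abs_mul, abs_of_nonneg hC]
  exact mul_le_mul_of_nonneg_left (abs_norm_sub_norm_le _ _) hC

theorem max_sub_mul_norm_mem_Pset {E : Type*} [NormedAddCommGroup E] {k : ℕ} {C a : ℝ}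
    (hC : 0 ≤ C) (ha : a ≤ 1) (R : Fin (k + 1) → E) :
    (fun i => max (a - C * ‖R i‖) 0) ∈ Pset k C R := by
  refine ⟨fun i => ⟨le_max_right _ _, max_le ?_ zero_le_one⟩, fun i j => ?_⟩
  · linarith [mul_nonneg hC (norm_nonneg (R i))]
  refine (abs_max_sub_max_le_max _ _ _ _).trans ?_
  rw [sub_self, abs_zero, max_eq_left (abs_nonneg _), sub_sub_sub_cancel_left, ← mul_sub,
    abs_mul, abs_of_nonneg hC, norm_sub_rev]
  exact mul_le_mul_of_nonneg_left (abs_norm_sub_norm_le _ _) hC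

theorem abs_sub_zero_le_of_mem_Pset {E : Type*} [NormedAddCommGroup E] {k : ℕ} {C : ℝ}
    {R : Fin (k + 1) → E} (hR : R 0 = 0) {p : Fin (k + 1) → ℝ} (hp : p ∈ Pset k C R)
    (i : Fin (k + 1)) : |p i - p 0| ≤ C * ‖R i‖ := by
  simpa [hR] using hp.2 i 0

theorem stmt14 {E : Type*} [NormedAddCommGroup E] (k m : ℕ) (C : ℝ) (hC : 0 < C)
    (Rp : Fin (k + 1) → E) (Rm : Fin (m + 1) → E)
    (hRp0 : Rp 0 = 0) (hRm0 : Rm 0 = 0)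
    (wp : Fin k → ℝ) (wm : Fin m → ℝ)
    (hwp : ∀ i, 0 ≤ wp i) (hwm : ∀ i, 0 ≤ wm i)
    (γ τ₀ : ℝ) (hτ₀ : τ₀ ∈ Set.Icc (-1 : ℝ) 1) :
    ∃ M : ℝ,
      IsGreatest ((fun pq : (Fin (k + 1) → ℝ) × (Fin (m + 1) → ℝ) =>
          rejProb wp wm pq.1 pq.2 γ) ''
        {pq | pq.1 ∈ Pset k C Rp ∧ pq.2 ∈ Pset m C Rm ∧
          pq.1 0 - pq.2 0 = τ₀}) M ∧
      IsGreatest ((fun p : ℝ =>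
          rejProb wp wm (fun i => min (p + C * ‖Rp i‖) 1)
            (fun i => max (p - τ₀ - C * ‖Rm i‖) 0) γ) ''
        Set.Icc (max 0 τ₀) (min 1 (1 + τ₀))) M := by
  obtain ⟨hτl, hτu⟩ := hτ₀
  have hne : (Set.Icc (max 0 τ₀) (min 1 (1 + τ₀))).Nonempty :=
    Set.nonempty_Icc.2 (max_le (le_min (by linarith) (by linarith))
      (le_min hτu (by linarith)))
  have hcont : Continuous fun p : ℝ => rejProb wp wm (fun i => min (p + C * ‖Rp i‖) 1)
      (fun i => max (p - τ₀ - C * ‖Rm i‖) 0) γ :=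
    (continuous_rejProb wp wm γ).comp
      (f := fun p : ℝ => ((fun i => min (p + C * ‖Rp i‖) 1 : Fin (k + 1) → ℝ),
        (fun i => max (p - τ₀ - C * ‖Rm i‖) 0 : Fin (m + 1) → ℝ))) (by fun_prop)
  obtain ⟨M, hM⟩ := (isCompact_Icc.image hcont).exists_isGreatest (hne.image _)
  refine ⟨M, ⟨?_, ?_⟩, hM⟩
  · obtain ⟨p, ⟨hpl, hpu⟩, rfl⟩ := hM.1
    obtain ⟨hp0, hpτ⟩ := max_le_iff.1 hpl
    obtain ⟨hp1, hpτ'⟩ := le_min_iff.1 hpu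
    refine ⟨(_, _), ⟨min_add_mul_norm_mem_Pset hC.le hp0 Rp,
      max_sub_mul_norm_mem_Pset hC.le (by linarith) Rm, ?_⟩, rfl⟩
    simp [hRp0, hRm0, hp1, hpτ]
  · rintro _ ⟨⟨p, q⟩, ⟨hp, hq, hpq⟩, rfl⟩
    dsimp only at hp hq hpq ⊢
    obtain ⟨hp0, hp1⟩ := hp.1 0
    obtain ⟨hq0, hq1⟩ := hq.1 0
    have hP := min_add_mul_norm_mem_Pset hC.le hp0 Rp
    have hQ := max_sub_mul_norm_mem_Pset (a := p 0 - τ₀) hC.le (by linarith) Rm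
    calc rejProb wp wm p q γ
        ≤ rejProb wp wm (fun i => min (p 0 + C * ‖Rp i‖) 1) q γ :=
          rejProb_mono_left wm γ hwp hp.1 hP.1 hq.1 fun i => le_min
            (by linarith [(abs_le.1 (abs_sub_zero_le_of_mem_Pset hRp0 hp i)).2]) (hp.1 i).2
      _ ≤ rejProb wp wm (fun i => min (p 0 + C * ‖Rp i‖) 1)
            (fun i => max (p 0 - τ₀ - C * ‖Rm i‖) 0) γ :=
          rejProb_anti_right wp γ hwm hP.1 hQ.1 hq.1 fun i => max_le
            (by linarith [(abs_le.1 (abs_sub_zero_le_of_mem_Pset hRm0 hq i)).1]) (hq.1 i).1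
      _ ≤ M := hM.2 ⟨p 0, ⟨max_le hp0 (by linarith), le_min hp1 (by linarith)⟩, rfl⟩
end

section
/- Assume ‖R_{1,+}‖ ≤ … ≤ ‖R_{n₊,+}‖ and ‖R_{1,−}‖ ≤ … ≤ ‖R_{n₋,−}‖. Then min over (w₊,w₋) ∈ W₊ × W₋ of max over (θ₊,θ₋) ∈ Θ₊ × Θ₋ of MSE_ate(w₊,w₋,θ₊,θ₋) equals the same min-max taken over (w₊,w₋) ∈ W₊¹ × W₋¹, where W₊¹ = {w ∈ W₊ : w₁ ≥ … ≥ w_{n₊} and wᵢ = 0 whenever C‖R_{i,+}‖ ≥ 1/2} and W₋¹ = {w ∈ W₋ : w₁ ≥ … ≥ w_{n₋} and wᵢ = 0 whenever C‖R_{i,−}‖ ≥ 1/2}. -/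
/- STATEMENT 18: the min-max value of the ATE problem over W₊ × W₋ equals the
   min-max value over W₊¹ × W₋¹ (nonincreasing weights that vanish whenever
   C‖Rᵢ‖ ≥ 1/2). -/

open Finset

/-- The bias term b(w,θ) = ∑ wᵢθᵢ − θ₀. -/
noncomputable def bFun (n : ℕ) (w : Fin n → ℝ) (θ : Fin (n + 1) → ℝ) : ℝ :=
  ∑ i, w i * θ i.succ - θ 0

/-- The variance term V(w,θ) = ∑ wᵢ²(1/4 − θᵢ²). -/
noncomputable def vFun (n : ℕ) (w : Fin n → ℝ) (θ : Fin (n + 1) → ℝ) : ℝ :=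
  ∑ i, (w i) ^ 2 * (1 / 4 - (θ i.succ) ^ 2)

/-- The mean squared error of the ATE estimator. -/
noncomputable def MSEate (k m : ℕ) (wp : Fin k → ℝ) (wm : Fin m → ℝ)
    (θp : Fin (k + 1) → ℝ) (θm : Fin (m + 1) → ℝ) : ℝ :=
  (bFun k wp θp) ^ 2 + vFun k wp θp + (bFun m wm θm) ^ 2 + vFun m wm θm -
    2 * bFun k wp θp * bFun m wm θm

/-- The extremal parameter `θᵢ = min (C‖Rᵢ‖ - t) (1/2)`, whose value at the origin is `-t`. -/
noncomputable def thetaProfile {E : Type*} [NormedAddCommGroup E] {n : ℕ} (C : ℝ)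
    (R : Fin (n + 1) → E) (t : ℝ) (i : Fin (n + 1)) : ℝ :=
  min (C * ‖R i‖ - t) (1 / 2)

section OneSample

variable {E : Type*} [NormedAddCommGroup E] {n : ℕ} {C : ℝ} {R : Fin (n + 1) → E} {t : ℝ}

theorem thetaProfile_zero (hR : R 0 = 0) (ht : 0 ≤ t) : thetaProfile C R t 0 = -t := by
  unfold thetaProfile
  rw [hR, norm_zero, min_eq_left (by linarith)]
  ring

theorem neg_le_thetaProfile (hC : 0 < C) (ht : 0 ≤ t) (i : Fin (n + 1)) :
    -t ≤ thetaProfile C R t i := by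
  have : 0 ≤ C * ‖R i‖ := by positivity
  exact le_min (by linarith) (by linarith)

theorem thetaProfile_le_half (i : Fin (n + 1)) : thetaProfile C R t i ≤ 1 / 2 :=
  min_le_right _ _

theorem thetaProfile_mem (hC : 0 < C) (ht : t ∈ Set.Icc (0 : ℝ) (1 / 2)) :
    thetaProfile C R t ∈ ThetaSet n C R := by
  refine ⟨fun i => ⟨?_, thetaProfile_le_half i⟩, fun i j => ?_⟩
  · have := neg_le_thetaProfile (R := R) hC ht.1 i
    linarith [ht.2]
  · have h1 : |thetaProfile C R t i - thetaProfile C R t j|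
        ≤ |(C * ‖R i‖ - t) - (C * ‖R j‖ - t)| := by
      simpa [thetaProfile] using
        abs_min_sub_min_le_max (C * ‖R i‖ - t) (1 / 2) (C * ‖R j‖ - t) (1 / 2)
    have h2 : (C * ‖R i‖ - t) - (C * ‖R j‖ - t) = C * (‖R i‖ - ‖R j‖) := by ring
    rw [h2, abs_mul, abs_of_pos hC] at h1
    exact h1.trans (mul_le_mul_of_nonneg_left (abs_norm_sub_norm_le _ _) hC.le)

theorem bFun_neg (w : Fin n → ℝ) (θ : Fin (n + 1) → ℝ) : bFun n w (-θ) = -bFun n w θ := by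
  simp [bFun, sum_neg_distrib]
  ring

theorem vFun_neg (w : Fin n → ℝ) (θ : Fin (n + 1) → ℝ) : vFun n w (-θ) = vFun n w θ := by
  simp [vFun]

theorem neg_mem_thetaSet {θ : Fin (n + 1) → ℝ} (h : θ ∈ ThetaSet n C R) :
    -θ ∈ ThetaSet n C R := by
  refine ⟨fun i => ?_, fun i j => ?_⟩
  · obtain ⟨h1, h2⟩ := h.1 i
    constructor <;> simp only [Pi.neg_apply] <;> linarith
  · have := h.2 j i
    rw [norm_sub_rev] at this
    convert this using 2
    simp only [Pi.neg_apply]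
    ring

/-- The bias at an extremal profile is nonnegative. -/
theorem bFun_thetaProfile_nonneg (hC : 0 < C) (hR : R 0 = 0) (ht : 0 ≤ t) {w : Fin n → ℝ}
    (hw : w ∈ Wset n) : 0 ≤ bFun n w (thetaProfile C R t) := by
  have h : ∑ i, w i * (-t) ≤ ∑ i, w i * thetaProfile C R t i.succ :=
    sum_le_sum fun i _ => mul_le_mul_of_nonneg_left (neg_le_thetaProfile hC ht _) (hw.2 i)
  rw [← sum_mul] at h
  unfold bFun
  rw [thetaProfile_zero hR ht]
  nlinarith [hw.1]

/-- Replacing `θ` with `θ₀ = -t ≤ 0` by the extremal profile increases bias and squared error. -/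
theorem le_thetaProfile_of_nonpos (hR : R 0 = 0) {w : Fin n → ℝ}
    (hw : w ∈ Wset n) {θ : Fin (n + 1) → ℝ} (hθ : θ ∈ ThetaSet n C R) (h0 : θ 0 = -t)
    (ht : 0 ≤ t) :
    bFun n w θ ≤ bFun n w (thetaProfile C R t) ∧
      (bFun n w θ) ^ 2 + vFun n w θ ≤
        (bFun n w (thetaProfile C R t)) ^ 2 + vFun n w (thetaProfile C R t) := by
  set θ' := thetaProfile C R t with hθ'
  have hL : ∀ i, |θ i + t| ≤ C * ‖R i‖ := fun i => by
    simpa [h0, hR] using hθ.2 i 0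
  have hle : ∀ i, θ i ≤ θ' i := fun i =>
    le_min (by linarith [(abs_le.1 (hL i)).2]) (hθ.1 i).2
  have hsum : ∀ i, 0 ≤ θ i + θ' i + 2 * t := fun i => by
    have h1 := (abs_le.1 (hL i)).1
    have h2 := (hθ.1 i).1
    rcases min_choice (C * ‖R i‖ - t) (1 / 2) with h | h <;>
      simp only [hθ', thetaProfile, h] <;> linarith
  have h0' : θ' 0 = -t := thetaProfile_zero hR ht
  have hb : bFun n w θ' - bFun n w θ = ∑ i, w i * (θ' i.succ - θ i.succ) := by
    simp only [bFun, h0, h0', mul_sub, sum_sub_distrib]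
    ring
  have hbs : bFun n w θ' + bFun n w θ =
      ∑ i, w i * (θ i.succ + θ' i.succ + 2 * t) + 2 * t * (1 - ∑ i, w i) := by
    simp only [bFun, h0, h0', mul_add, sum_add_distrib, ← sum_mul]
    ring
  have hv : vFun n w θ - vFun n w θ' =
      ∑ i, (w i * (θ' i.succ - θ i.succ)) * (w i * (θ i.succ + θ' i.succ)) := by
    simp only [vFun, ← sum_sub_distrib]
    exact sum_congr rfl fun i _ => by ring
  have hd : ∀ i : Fin n, 0 ≤ w i * (θ' i.succ - θ i.succ) := fun i =>
    mul_nonneg (hw.2 i) (sub_nonneg.2 (hle _))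
  have hbound : ∀ i : Fin n, w i * (θ i.succ + θ' i.succ) ≤ bFun n w θ' + bFun n w θ := by
    intro i
    have h1 : w i * (θ i.succ + θ' i.succ + 2 * t) ≤
        ∑ i, w i * (θ i.succ + θ' i.succ + 2 * t) :=
      single_le_sum (f := fun i => w i * (θ i.succ + θ' i.succ + 2 * t))
        (fun j _ => mul_nonneg (hw.2 j) (hsum _)) (mem_univ i)
    rw [hbs]
    nlinarith [hw.1, hw.2 i]
  refine ⟨sub_nonneg.1 (hb ▸ sum_nonneg fun i _ => hd i), ?_⟩
  have key : vFun n w θ - vFun n w θ' ≤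
      (bFun n w θ' - bFun n w θ) * (bFun n w θ' + bFun n w θ) := by
    rw [hv, hb, sum_mul]
    exact sum_le_sum fun i _ => mul_le_mul_of_nonneg_left (hbound i) (hd i)
  linarith

/-- A parameter with nonnegative bias is dominated by one whose value at the origin is `≤ 0`. -/
theorem exists_nonpos_dominating {w : Fin n → ℝ} (hw : w ∈ Wset n) {θ : Fin (n + 1) → ℝ}
    (hθ : θ ∈ ThetaSet n C R) (hb : 0 ≤ bFun n w θ) :
    ∃ θ' ∈ ThetaSet n C R, θ' 0 ≤ 0 ∧ bFun n w θ ≤ bFun n w θ' ∧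
      (bFun n w θ) ^ 2 + vFun n w θ ≤ (bFun n w θ') ^ 2 + vFun n w θ' := by
  rcases le_total (θ 0) 0 with h | h
  · exact ⟨θ, hθ, h, le_rfl, le_rfl⟩
  have hnonneg : ∀ i, 0 ≤ max (θ i - θ 0) 0 := fun i => le_max_right _ _
  have habs : ∀ i, max (θ i - θ 0) 0 ≤ |θ i| := fun i =>
    max_le (by linarith [le_abs_self (θ i)]) (abs_nonneg _)
  have hble : bFun n w θ ≤ bFun n w fun i => max (θ i - θ 0) 0 := by
    have h1 : ∑ i, w i * (θ i.succ - θ 0) ≤ ∑ i, w i * max (θ i.succ - θ 0) 0 :=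
      sum_le_sum fun i _ => mul_le_mul_of_nonneg_left (le_max_left _ _) (hw.2 i)
    simp only [mul_sub, sum_sub_distrib, ← sum_mul] at h1
    simp only [bFun, sub_self, max_self, sub_zero]
    nlinarith [hw.1]
  have hvle : vFun n w θ ≤ vFun n w fun i => max (θ i - θ 0) 0 := by
    refine sum_le_sum fun i _ => mul_le_mul_of_nonneg_left ?_ (sq_nonneg _)
    have := pow_le_pow_left₀ (hnonneg i.succ) (habs i.succ) 2
    rw [sq_abs] at this
    linarith
  refine ⟨fun i => max (θ i - θ 0) 0, ⟨fun i => ⟨by linarith [hnonneg i], ?_⟩, fun i j => ?_⟩,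
    by simp, hble, add_le_add (pow_le_pow_left₀ hb hble 2) hvle⟩
  · exact (habs i).trans (abs_le.2 ⟨(hθ.1 i).1, (hθ.1 i).2⟩)
  · refine le_trans ?_ (hθ.2 i j)
    simpa using abs_max_sub_max_le_max (θ i - θ 0) 0 (θ j - θ 0) 0

theorem exists_thetaProfile_dominating (hR : R 0 = 0) {w : Fin n → ℝ}
    (hw : w ∈ Wset n) {θ : Fin (n + 1) → ℝ} (hθ : θ ∈ ThetaSet n C R) :
    ∃ t ∈ Set.Icc (0 : ℝ) (1 / 2), |bFun n w θ| ≤ bFun n w (thetaProfile C R t) ∧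
      (bFun n w θ) ^ 2 + vFun n w θ ≤
        (bFun n w (thetaProfile C R t)) ^ 2 + vFun n w (thetaProfile C R t) := by
  wlog hb : 0 ≤ bFun n w θ generalizing θ
  · have := this (neg_mem_thetaSet hθ) (by rw [bFun_neg]; linarith)
    simpa only [bFun_neg, vFun_neg, abs_neg, neg_sq] using this
  obtain ⟨θ', hθ', h0, hb', hq⟩ := exists_nonpos_dominating hw hθ hb
  obtain ⟨h1, h2⟩ := le_thetaProfile_of_nonpos hR hw hθ' (neg_neg (θ' 0)).symm
    (neg_nonneg.2 h0)
  refine ⟨-θ' 0, ⟨neg_nonneg.2 h0, by linarith [(hθ'.1 0).1]⟩, ?_, hq.trans h2⟩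
  rw [abs_of_nonneg hb]
  exact hb'.trans h1

/-- `w'` is feasible and, at every extremal profile, has no larger bias and squared error
than `w`. -/
def ProfileDominates (C : ℝ) (R : Fin (n + 1) → E) (w' w : Fin n → ℝ) : Prop :=
  w' ∈ Wset n ∧ ∀ t ∈ Set.Icc (0 : ℝ) (1 / 2),
    bFun n w' (thetaProfile C R t) ≤ bFun n w (thetaProfile C R t) ∧
      (bFun n w' (thetaProfile C R t)) ^ 2 + vFun n w' (thetaProfile C R t) ≤
        (bFun n w (thetaProfile C R t)) ^ 2 + vFun n w (thetaProfile C R t)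

theorem ProfileDominates.trans {u v w : Fin n → ℝ} (h : ProfileDominates C R u v)
    (h' : ProfileDominates C R v w) : ProfileDominates C R u w :=
  ⟨h.1, fun t ht => ⟨(h.2 t ht).1.trans (h'.2 t ht).1, (h.2 t ht).2.trans (h'.2 t ht).2⟩⟩

theorem sum_eq_add_add_sum_erase_erase {ι : Type*} [Fintype ι] [DecidableEq ι] {i j : ι}
    (hij : i ≠ j) (f : ι → ℝ) :
    ∑ l, f l = f i + f j + ∑ l ∈ (univ.erase i).erase j, f l := by
  rw [← add_sum_erase univ f (mem_univ i),
    ← add_sum_erase (univ.erase i) f (mem_erase.2 ⟨hij.symm, mem_univ j⟩), add_assoc]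

theorem profileDominates_swap (hC : 0 < C) (hR : R 0 = 0)
    (hord : ∀ i j : Fin n, i ≤ j → ‖R i.succ‖ ≤ ‖R j.succ‖) {w : Fin n → ℝ}
    (hw : w ∈ Wset n) {i j : Fin n} (hij : i < j) (hlt : w i < w j) :
    ProfileDominates C R (w ∘ Equiv.swap i j) w := by
  refine ⟨⟨?_, fun l => hw.2 _⟩, fun t ht => ?_⟩
  · exact (Equiv.sum_comp (Equiv.swap i j) w).trans_le hw.1
  set θ := thetaProfile C R t with hθ
  have h0 : θ 0 = -t := thetaProfile_zero hR ht.1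
  have hlow : ∀ l, -t ≤ θ l := neg_le_thetaProfile hC ht.1
  have hmono : θ i.succ ≤ θ j.succ := by
    refine min_le_min_right _ ?_
    have := mul_le_mul_of_nonneg_left (hord i j hij.le) hC.le
    linarith
  set s := (univ.erase i).erase j with hs
  have hrest : ∀ l ∈ s, (w ∘ Equiv.swap i j) l = w l := fun l hl => by
    rw [hs, mem_erase, mem_erase] at hl
    simp [Equiv.swap_apply_of_ne_of_ne hl.2.1 hl.1]
  have hsum := sum_eq_add_add_sum_erase_erase hij.ne w
  rw [← hs] at hsum
  have hS : 0 ≤ ∑ l ∈ s, w l * θ l.succ + t := by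
    have h : ∑ l ∈ s, w l * (-t) ≤ ∑ l ∈ s, w l * θ l.succ :=
      sum_le_sum fun l _ => mul_le_mul_of_nonneg_left (hlow _) (hw.2 l)
    rw [← sum_mul] at h
    nlinarith [hw.1, hw.2 i, hw.2 j, ht.1]
  have hb : bFun n w θ = w i * θ i.succ + w j * θ j.succ + (∑ l ∈ s, w l * θ l.succ + t) := by
    rw [bFun, sum_eq_add_add_sum_erase_erase hij.ne, h0]
    ring
  have hb' : bFun n (w ∘ Equiv.swap i j) θ =
      w j * θ i.succ + w i * θ j.succ + (∑ l ∈ s, w l * θ l.succ + t) := by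
    rw [bFun, sum_eq_add_add_sum_erase_erase hij.ne, h0, ← hs,
      sum_congr rfl fun l hl => by rw [hrest l hl]]
    simp only [Function.comp_apply, Equiv.swap_apply_left, Equiv.swap_apply_right]
    ring
  have hv : vFun n w θ = w i ^ 2 * (1 / 4 - θ i.succ ^ 2) + w j ^ 2 * (1 / 4 - θ j.succ ^ 2) +
      ∑ l ∈ s, w l ^ 2 * (1 / 4 - θ l.succ ^ 2) := by
    rw [vFun, sum_eq_add_add_sum_erase_erase hij.ne]
  have hv' : vFun n (w ∘ Equiv.swap i j) θ =
      w j ^ 2 * (1 / 4 - θ i.succ ^ 2) + w i ^ 2 * (1 / 4 - θ j.succ ^ 2) +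
      ∑ l ∈ s, w l ^ 2 * (1 / 4 - θ l.succ ^ 2) := by
    rw [vFun, sum_eq_add_add_sum_erase_erase hij.ne, ← hs,
      sum_congr rfl fun l hl => by rw [hrest l hl]]
    simp only [Function.comp_apply, Equiv.swap_apply_left, Equiv.swap_apply_right]
  have hp : 0 ≤ (w j - w i) * (θ j.succ - θ i.succ) :=
    mul_nonneg (sub_nonneg.2 hlt.le) (sub_nonneg.2 hmono)
  rw [hb, hb', hv, hv']
  exact ⟨by linarith, by nlinarith [mul_nonneg hp hS]⟩

theorem exists_antitone_profileDominates (hC : 0 < C) (hR : R 0 = 0)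
    (hord : ∀ i j : Fin n, i ≤ j → ‖R i.succ‖ ≤ ‖R j.succ‖) {w : Fin n → ℝ}
    (hw : w ∈ Wset n) : ∃ w', Antitone w' ∧ ProfileDominates C R w' w := by
  have key := Tuple.bubble_sort_induction (f := -w)
    (P := fun g => ProfileDominates C R (-g) w)
    (by simpa using ⟨hw, fun t _ => ⟨le_rfl, le_rfl⟩⟩)
    (fun g i j hij hlt hg =>
      (profileDominates_swap hC hR hord hg.1 hij (by simpa using hlt)).trans hg)
  exact ⟨_, (Tuple.monotone_sort (-w)).neg, key⟩

/-- Dropping the observations with `C‖Rᵢ‖ ≥ 1/2` reduces the bias and the variance. -/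
theorem profileDominates_ite (hC : 0 < C) (hR : R 0 = 0) {w : Fin n → ℝ} (hw : w ∈ Wset n) :
    ProfileDominates C R (fun i => if 1 / 2 ≤ C * ‖R i.succ‖ then 0 else w i) w := by
  have hle : ∀ i, (if 1 / 2 ≤ C * ‖R i.succ‖ then 0 else w i) ≤ w i := fun i => by
    split_ifs
    · exact hw.2 i
    · exact le_rfl
  have hnn : ∀ i, 0 ≤ if 1 / 2 ≤ C * ‖R i.succ‖ then 0 else w i := fun i => by
    split_ifs
    · exact le_rfl
    · exact hw.2 i
  have hmem : (fun i => if 1 / 2 ≤ C * ‖R i.succ‖ then 0 else w i) ∈ Wset n :=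
    ⟨(sum_le_sum fun i _ => hle i).trans hw.1, hnn⟩
  refine ⟨hmem, fun t ht => ?_⟩
  have hb : bFun n (fun i => if 1 / 2 ≤ C * ‖R i.succ‖ then 0 else w i) (thetaProfile C R t) ≤
      bFun n w (thetaProfile C R t) := by
    refine sub_le_sub_right (sum_le_sum fun i _ => ?_) _
    dsimp only
    split_ifs with h
    · rw [zero_mul]
      exact mul_nonneg (hw.2 i) (le_min (by linarith [ht.2]) (by norm_num))
    · exact le_rfl
  refine ⟨hb, add_le_add
    (pow_le_pow_left₀ (bFun_thetaProfile_nonneg hC hR ht.1 hmem) hb 2)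
    (sum_le_sum fun i _ => mul_le_mul_of_nonneg_right
      (pow_le_pow_left₀ (hnn i) (hle i) 2) ?_)⟩
  have := (thetaProfile_mem (R := R) hC ht).1 i.succ
  nlinarith [this.1, this.2]

theorem exists_profileDominates (hC : 0 < C) (hR : R 0 = 0)
    (hord : ∀ i j : Fin n, i ≤ j → ‖R i.succ‖ ≤ ‖R j.succ‖) {w : Fin n → ℝ}
    (hw : w ∈ Wset n) :
    ∃ w' ∈ {w ∈ Wset n | (∀ i j : Fin n, i ≤ j → w j ≤ w i) ∧
      ∀ i : Fin n, 1 / 2 ≤ C * ‖R i.succ‖ → w i = 0}, ProfileDominates C R w' w := by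
  obtain ⟨w', hanti, hdom⟩ := exists_antitone_profileDominates hC hR hord hw
  have hdom' := profileDominates_ite hC hR hdom.1
  refine ⟨_, ⟨hdom'.1, fun i j hij => ?_, fun i hi => if_pos hi⟩, hdom'.trans hdom⟩
  by_cases hj : 1 / 2 ≤ C * ‖R j.succ‖
  · rw [if_pos hj]
    exact hdom'.1.2 i
  · have hi : ¬ 1 / 2 ≤ C * ‖R i.succ‖ := fun h =>
      hj (h.trans (mul_le_mul_of_nonneg_left (hord i j hij) hC.le))
    rw [if_neg hj, if_neg hi]
    exact hanti hij

theorem exists_dominating_parameter (hC : 0 < C) (hR : R 0 = 0) {w w' : Fin n → ℝ}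
    (h : ProfileDominates C R w' w) {θ : Fin (n + 1) → ℝ} (hθ : θ ∈ ThetaSet n C R) :
    ∃ θ' ∈ ThetaSet n C R, |bFun n w' θ| ≤ bFun n w θ' ∧
      (bFun n w' θ) ^ 2 + vFun n w' θ ≤ (bFun n w θ') ^ 2 + vFun n w θ' := by
  obtain ⟨t, ht, h1, h2⟩ := exists_thetaProfile_dominating hR h.1 hθ
  exact ⟨_, thetaProfile_mem hC ht, h1.trans (h.2 t ht).1, h2.trans (h.2 t ht).2⟩

theorem isCompact_thetaSet : IsCompact (ThetaSet n C R) := by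
  have hbox : IsCompact (Set.univ.pi fun _ : Fin (n + 1) => Set.Icc (-(1 / 2) : ℝ) (1 / 2)) :=
    isCompact_univ_pi fun _ => isCompact_Icc
  refine hbox.of_isClosed_subset ?_ fun θ hθ i _ => hθ.1 i
  simp only [ThetaSet, Set.ofPred_and, Set.ofPred_forall, Set.mem_Icc]
  exact (isClosed_iInter fun i => (isClosed_le (by fun_prop) (by fun_prop)).inter
      (isClosed_le (by fun_prop) (by fun_prop))).inter
    (isClosed_iInter fun i => isClosed_iInter fun j => isClosed_le (by fun_prop) (by fun_prop))

theorem isCompact_wset : IsCompact (Wset n) := by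
  have hbox : IsCompact (Set.univ.pi fun _ : Fin n => Set.Icc (0 : ℝ) 1) :=
    isCompact_univ_pi fun _ => isCompact_Icc
  refine hbox.of_isClosed_subset ?_ fun w hw i _ =>
    ⟨hw.2 i, (single_le_sum (fun j _ => hw.2 j) (mem_univ i)).trans hw.1⟩
  simp only [Wset, Set.ofPred_and, Set.ofPred_forall]
  exact (isClosed_le (by fun_prop) (by fun_prop)).inter
    (isClosed_iInter fun i => isClosed_le (by fun_prop) (by fun_prop))

theorem zero_mem_wset : (0 : Fin n → ℝ) ∈ Wset n := by simp [Wset]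

theorem thetaSet_nonempty (hC : 0 < C) : (ThetaSet n C R).Nonempty :=
  ⟨_, thetaProfile_mem hC ⟨le_rfl, by norm_num⟩⟩

end OneSample

theorem continuous_MSEate (k m : ℕ) :
    Continuous fun p : ((Fin k → ℝ) × (Fin m → ℝ)) × ((Fin (k + 1) → ℝ) × (Fin (m + 1) → ℝ)) =>
      MSEate k m p.1.1 p.1.2 p.2.1 p.2.2 := by
  unfold MSEate bFun vFun
  fun_prop

theorem sSup_MSEate_le {E : Type*} [NormedAddCommGroup E] {k m : ℕ} {C : ℝ} (hC : 0 < C)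
    {Rp : Fin (k + 1) → E} {Rm : Fin (m + 1) → E} (hRp0 : Rp 0 = 0) (hRm0 : Rm 0 = 0)
    {wp wp' : Fin k → ℝ} {wm wm' : Fin m → ℝ} (hp : ProfileDominates C Rp wp' wp)
    (hm : ProfileDominates C Rm wm' wm) :
    sSup ((fun θ : (Fin (k + 1) → ℝ) × (Fin (m + 1) → ℝ) => MSEate k m wp' wm' θ.1 θ.2) ''
        ((ThetaSet k C Rp) ×ˢ (ThetaSet m C Rm))) ≤
      sSup ((fun θ : (Fin (k + 1) → ℝ) × (Fin (m + 1) → ℝ) => MSEate k m wp wm θ.1 θ.2) ''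
        ((ThetaSet k C Rp) ×ˢ (ThetaSet m C Rm))) := by
  refine csSup_le (((thetaSet_nonempty hC).prod (thetaSet_nonempty hC)).image _) ?_
  rintro _ ⟨⟨θp, θm⟩, ⟨hθp, hθm⟩, rfl⟩
  obtain ⟨ηp, hηp, hbp, hqp⟩ := exists_dominating_parameter hC hRp0 hp hθp
  obtain ⟨ηm, hηm, hbm, hqm⟩ := exists_dominating_parameter hC hRm0 hm hθm
  have hcont : Continuous fun θ : (Fin (k + 1) → ℝ) × (Fin (m + 1) → ℝ) =>
      MSEate k m wp wm θ.1 θ.2 := by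
    unfold MSEate bFun vFun
    fun_prop
  have hbdd := ((isCompact_thetaSet (R := Rp) (C := C)).prod
    (isCompact_thetaSet (R := Rm) (C := C))).bddAbove_image hcont.continuousOn
  refine le_trans ?_ (le_csSup hbdd ⟨(ηp, -ηm), ⟨hηp, neg_mem_thetaSet hηm⟩, rfl⟩)
  have hcross : -(bFun k wp' θp * bFun m wm' θm) ≤ bFun k wp ηp * bFun m wm ηm :=
    (neg_le_abs _).trans ((abs_mul _ _).trans_le
      (mul_le_mul hbp hbm (abs_nonneg _) ((abs_nonneg _).trans hbp)))
  simp only [MSEate, bFun_neg, vFun_neg]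
  linarith

theorem stmt18 {E : Type*} [NormedAddCommGroup E] (k m : ℕ) (C : ℝ) (hC : 0 < C)
    (Rp : Fin (k + 1) → E) (Rm : Fin (m + 1) → E)
    (hRp0 : Rp 0 = 0) (hRm0 : Rm 0 = 0)
    (hordp : ∀ i j : Fin k, i ≤ j → ‖Rp i.succ‖ ≤ ‖Rp j.succ‖)
    (hordm : ∀ i j : Fin m, i ≤ j → ‖Rm i.succ‖ ≤ ‖Rm j.succ‖) :
    ∃ M : ℝ,
      IsLeast ((fun w : (Fin k → ℝ) × (Fin m → ℝ) =>
          sSup ((fun θ : (Fin (k + 1) → ℝ) × (Fin (m + 1) → ℝ) =>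
              MSEate k m w.1 w.2 θ.1 θ.2) ''
            ((ThetaSet k C Rp) ×ˢ (ThetaSet m C Rm)))) ''
        ((Wset k) ×ˢ (Wset m))) M ∧
      IsLeast ((fun w : (Fin k → ℝ) × (Fin m → ℝ) =>
          sSup ((fun θ : (Fin (k + 1) → ℝ) × (Fin (m + 1) → ℝ) =>
              MSEate k m w.1 w.2 θ.1 θ.2) ''
            ((ThetaSet k C Rp) ×ˢ (ThetaSet m C Rm)))) ''
        (({w ∈ Wset k | (∀ i j : Fin k, i ≤ j → w j ≤ w i) ∧
            ∀ i : Fin k, 1 / 2 ≤ C * ‖Rp i.succ‖ → w i = 0}) ×ˢ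
          ({w ∈ Wset m | (∀ i j : Fin m, i ≤ j → w j ≤ w i) ∧
            ∀ i : Fin m, 1 / 2 ≤ C * ‖Rm i.succ‖ → w i = 0}))) M := by
  set F : (Fin k → ℝ) × (Fin m → ℝ) → ℝ := fun w =>
    sSup ((fun θ : (Fin (k + 1) → ℝ) × (Fin (m + 1) → ℝ) => MSEate k m w.1 w.2 θ.1 θ.2) ''
      ((ThetaSet k C Rp) ×ˢ (ThetaSet m C Rm)))
  have hF : Continuous F := by
    refine IsCompact.continuous_sSup (isCompact_thetaSet.prod isCompact_thetaSet) ?_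
    exact continuous_MSEate k m
  obtain ⟨w, hw, hmin⟩ := (isCompact_wset.prod isCompact_wset).exists_isMinOn
    ⟨(0, 0), Set.mk_mem_prod zero_mem_wset zero_mem_wset⟩ hF.continuousOn
  obtain ⟨wp, hwp, hp⟩ := exists_profileDominates hC hRp0 hordp hw.1
  obtain ⟨wm, hwm, hm⟩ := exists_profileDominates hC hRm0 hordm hw.2
  refine ⟨_, ⟨⟨w, hw, rfl⟩, ?_⟩, ⟨⟨(wp, wm), ⟨hwp, hwm⟩, ?_⟩, ?_⟩⟩
  · rintro _ ⟨v, hv, rfl⟩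
    exact hmin hv
  · exact le_antisymm (sSup_MSEate_le hC hRp0 hRm0 hp hm)
      (hmin (Set.mk_mem_prod hwp.1 hwm.1))
  · rintro _ ⟨v, hv, rfl⟩
    exact hmin (Set.mk_mem_prod hv.1.1 hv.2.1)
end

section
/- Let σ₁,…,σₙ > 0, ε > 0, and let θ* ∈ F maximize the coordinate θ₀ over the set F = {θ ∈ Θ_g : ∑_{i=1}^n θᵢ²/σᵢ² ≤ ε²/4} (i.e., θ* ∈ F and θ*₀ ≥ θ₀ for all θ ∈ F). Then (i) ∑_{i=1}^n (θ*ᵢ)²/σᵢ² = ε²/4, and (ii) θ*ᵢ ≥ 0 for all i = 1,…,n. -/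
/- STATEMENT 19 (Lemma lem:modulus (i)–(ii)): if θ* maximizes θ₀ over
   F = {θ ∈ Θ_g : ∑ θᵢ²/σᵢ² ≤ ε²/4}, then the constraint binds,
   ∑ (θ*ᵢ)²/σᵢ² = ε²/4, and θ*ᵢ ≥ 0 for all i = 1,…,n. -/

open Finset

theorem add_const_mem_ThetaG {E : Type*} [NormedAddCommGroup E] {n : ℕ} {C : ℝ}
    {R : Fin (n + 1) → E} {θ : Fin (n + 1) → ℝ} (hθ : θ ∈ ThetaG n C R) (t : ℝ) :
    (fun i => θ i + t) ∈ ThetaG n C R := fun i j => by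
  simpa using hθ i j

theorem posPart_mem_ThetaG {E : Type*} [NormedAddCommGroup E] {n : ℕ} {C : ℝ}
    {R : Fin (n + 1) → E} {θ : Fin (n + 1) → ℝ} (hθ : θ ∈ ThetaG n C R) :
    (fun i => max (θ i) 0) ∈ ThetaG n C R := fun i j =>
  (abs_max_sub_max_le_abs (θ i) (θ j) 0).trans (hθ i j)

/-- A point with slack in the quadratic constraint can be shifted up within the feasible set. -/
theorem exists_feasible_gt_of_sum_lt {E : Type*} [NormedAddCommGroup E] {n : ℕ} {C : ℝ}
    {R : Fin (n + 1) → E} (σ : Fin n → ℝ) {b : ℝ} {θ : Fin (n + 1) → ℝ}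
    (hθ : θ ∈ ThetaG n C R) (hlt : (∑ i, (θ i.succ) ^ 2 / (σ i) ^ 2) < b) :
    ∃ θ' ∈ ThetaG n C R, (∑ i, (θ' i.succ) ^ 2 / (σ i) ^ 2) ≤ b ∧ θ 0 < θ' 0 := by
  have hcont : Continuous fun t : ℝ => ∑ i, (θ (Fin.succ i) + t) ^ 2 / (σ i) ^ 2 := by
    fun_prop
  have hnear : ∀ᶠ t in nhds (0 : ℝ), ∑ i, (θ (Fin.succ i) + t) ^ 2 / (σ i) ^ 2 < b :=
    hcont.continuousAt.eventually_lt continuousAt_const (by simpa using hlt)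
  obtain ⟨t, ht, htpos⟩ :=
    ((hnear.filter_mono nhdsWithin_le_nhds).and
      (self_mem_nhdsWithin : Set.Ioi (0 : ℝ) ∈ nhdsWithin 0 (Set.Ioi 0))).exists
  exact ⟨_, add_const_mem_ThetaG hθ t, ht.le, lt_add_of_pos_right _ htpos⟩

theorem stmt19 {E : Type*} [NormedAddCommGroup E] (n : ℕ) (hn : 1 ≤ n)
    (C : ℝ) (hC : 0 < C) (R : Fin (n + 1) → E) (hR0 : R 0 = 0)
    (σ : Fin n → ℝ) (hσ : ∀ i, 0 < σ i) (ε : ℝ) (hε : 0 < ε)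
    (θs : Fin (n + 1) → ℝ)
    (hθsG : θs ∈ ThetaG n C R)
    (hθsF : (∑ i, (θs i.succ) ^ 2 / (σ i) ^ 2) ≤ ε ^ 2 / 4)
    (hmax : ∀ θ ∈ ThetaG n C R,
      (∑ i, (θ i.succ) ^ 2 / (σ i) ^ 2) ≤ ε ^ 2 / 4 → θ 0 ≤ θs 0) :
    (∑ i, (θs i.succ) ^ 2 / (σ i) ^ 2) = ε ^ 2 / 4 ∧
    ∀ i : Fin n, 0 ≤ θs i.succ := by
  refine ⟨hθsF.antisymm (le_of_not_gt fun hlt => ?_), fun k => le_of_not_gt fun hk => ?_⟩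
  · obtain ⟨θ, hθ, hF, h0⟩ := exists_feasible_gt_of_sum_lt σ hθsG hlt
    exact (hmax θ hθ hF).not_gt h0
  · have hsum : (∑ i, (max (θs (Fin.succ i)) 0) ^ 2 / (σ i) ^ 2) <
        ∑ i, (θs (Fin.succ i)) ^ 2 / (σ i) ^ 2 := by
      refine sum_lt_sum (fun i _ => ?_) ⟨k, mem_univ k, ?_⟩
      · refine div_le_div_of_nonneg_right ?_ (sq_nonneg _)
        rcases le_total (θs i.succ) 0 with h | h
        · simpa [h] using sq_nonneg (θs i.succ)
        · simp [h]
      · have := hσ k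
        have := sq_pos_of_neg hk
        simp only [max_eq_right hk.le]
        rw [zero_pow two_ne_zero, zero_div]
        positivity
    obtain ⟨θ, hθ, hF, h0⟩ :=
      exists_feasible_gt_of_sum_lt σ (posPart_mem_ThetaG hθsG) (hsum.trans_le hθsF)
    exact (hmax θ hθ hF).not_gt ((le_max_left _ _).trans_lt h0)
end
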